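/- arXiv:2104.05420 — 6 statements merged into one kernel-verified Lean document; each statement's English description precedes it below -/
import Mathlib

section
/- Let N ≥ 1, q = 2^N, and let π be a permutation of {0,…,q−1}. Define φ_N : [0,1) → X_N by φ_N(x) = (⌊qx⌋, (⌊2^{N+i} x⌋ mod 2)_{i≥1}). Then φ_N is injective and measurable, the pushforward of Lebesgue measure on [0,1) under φ_N equals μ_N, the complement of the image of φ_N is μ_N-null, and there exists a homeomorphism G of X_N which is induced by an automorphism of the grafted binary tree T_N, preserves μ_N, and satisfies G ∘ φ_N = φ_N ∘ F_π on [0,1). -/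
open MeasureTheory Set Function
open scoped ENNReal

noncomputable section

/-- `A` is the von Neumann–Kakutani map on `[0,1)`:
`A x = x - (1 - 3·2⁻ⁿ)` for `x ∈ [1 - 2^(1-n), 1 - 2^(-n))`, `n ≥ 1`. -/
def IsVNK (A : ℝ → ℝ) : Prop :=
  ∀ n : ℕ, 1 ≤ n →
    ∀ x ∈ Set.Ico (1 - (2:ℝ) ^ (1 - (n:ℤ))) (1 - (2:ℝ) ^ (-(n:ℤ))),
      A x = x - (1 - 3 * (2:ℝ) ^ (-(n:ℤ)))

/-- `R` is the interval exchange of the `q` intervals of length `1/q` determined by the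
permutation `π`: `R x = x + (π p - p)/q` for `x ∈ [p/q, (p+1)/q)`. -/
def IsIET (q : ℕ) (π : Equiv.Perm (Fin q)) (R : ℝ → ℝ) : Prop :=
  ∀ p : Fin q,
    ∀ x ∈ Set.Ico (((p : ℕ) : ℝ) / (q : ℝ)) ((((p : ℕ) : ℝ) + 1) / (q : ℝ)),
      R x = x + (((π p : ℕ) : ℝ) - ((p : ℕ) : ℝ)) / (q : ℝ)

/-- The set of periodic points of `F` in `[0,1)`. -/
def Iper (F : ℝ → ℝ) : Set ℝ :=
  {x ∈ Set.Ico (0:ℝ) 1 | ∃ k, 1 ≤ k ∧ F^[k] x = x}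

/-- The set of non-periodic points of `F` in `[0,1)`. -/
def Inp (F : ℝ → ℝ) : Set ℝ := Set.Ico (0:ℝ) 1 \ Iper F

/-- The Bernoulli measure on `X_N = {0,…,2^N-1} × {0,1}^ℕ`: the product of the uniform
measure on `Fin (2^N)` and the (1/2,1/2) Bernoulli measure, characterized by its values
on cylinders. -/
def IsBernoulliXN (N : ℕ) (μ : Measure (Fin (2^N) × (ℕ → Bool))) : Prop :=
  ∀ (p : Fin (2^N)) (n : ℕ) (u : Fin n → Bool),
    μ {x | x.1 = p ∧ ∀ i : Fin n, x.2 (i : ℕ) = u i}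
      = ((2:ℝ≥0∞) ^ N)⁻¹ * ((2:ℝ≥0∞)⁻¹) ^ n

/-- `G` is induced by an automorphism of the grafted binary tree `T_N`: whenever two points
of `X_N` have the same first coordinate and their tails agree in the first `n` coordinates,
so do their images. -/
def InducedByTreeAut (N : ℕ)
    (G : Fin (2^N) × (ℕ → Bool) → Fin (2^N) × (ℕ → Bool)) : Prop :=
  ∀ (n : ℕ) (x y : Fin (2^N) × (ℕ → Bool)),
    x.1 = y.1 → (∀ i < n, x.2 i = y.2 i) →
      (G x).1 = (G y).1 ∧ ∀ i < n, (G x).2 i = (G y).2 i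

/-- The map `φ_N : [0,1) → X_N`, `φ_N x = (⌊2^N x⌋, (⌊2^(N+i) x⌋ mod 2)_{i ≥ 1})`
(the `%` in the first coordinate is only there to produce an element of `Fin (2^N)`;
for `x ∈ [0,1)` one has `⌊2^N x⌋ ∈ {0,…,2^N-1}` already). -/
def phiN (N : ℕ) (x : ℝ) : Fin (2^N) × (ℕ → Bool) :=
  (⟨(⌊(2:ℝ)^N * x⌋).toNat % 2^N, Nat.mod_lt _ (Nat.two_pow_pos N)⟩,
   fun i => decide (⌊(2:ℝ)^(N + i + 1) * x⌋ % 2 = 1))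

/-- The cylinder of `X_N` of depth `n` around `y`. -/
def cylXN {N : ℕ} (y : Fin (2^N) × (ℕ → Bool)) (n : ℕ) : Set (Fin (2^N) × (ℕ → Bool)) :=
  {x | x.1 = y.1 ∧ ∀ i < n, x.2 i = y.2 i}

theorem mem_cylXN_self {N : ℕ} (y : Fin (2^N) × (ℕ → Bool)) (n : ℕ) : y ∈ cylXN y n :=
  ⟨rfl, fun _ _ => rfl⟩

theorem isTopologicalBasis_cylXN (N : ℕ) :
    TopologicalSpace.IsTopologicalBasis
      {s : Set (Fin (2^N) × (ℕ → Bool)) | ∃ y n, s = cylXN y n} := by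
  convert (isTopologicalBasis_singletons (Fin (2^N))).prod
    (PiNat.isTopologicalBasis_cylinders (fun _ : ℕ => Bool)) using 1
  have key (p : Fin (2^N)) (w : ℕ → Bool) (n : ℕ) :
      ({p} : Set (Fin (2^N))) ×ˢ PiNat.cylinder w n = cylXN (p, w) n := by
    ext x
    simp [cylXN, PiNat.cylinder]
  ext s
  simp only [mem_ofPred_eq, mem_image2]
  constructor
  · rintro ⟨y, n, rfl⟩
    exact ⟨{y.1}, ⟨y.1, rfl⟩, PiNat.cylinder y.2 n, ⟨y.2, n, rfl⟩, key _ _ _⟩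
  · rintro ⟨_, ⟨p, rfl⟩, _, ⟨w, n, rfl⟩, rfl⟩
    exact ⟨(p, w), n, key _ _ _⟩

theorem measurableSet_cylXN {N : ℕ} (y : Fin (2^N) × (ℕ → Bool)) (n : ℕ) :
    MeasurableSet (cylXN y n) :=
  ((isTopologicalBasis_cylXN N).isOpen ⟨y, n, rfl⟩).measurableSet

theorem isPiSystem_cylXN (N : ℕ) :
    IsPiSystem {s : Set (Fin (2^N) × (ℕ → Bool)) | ∃ y n, s = cylXN y n} := by
  rintro _ ⟨y, n, rfl⟩ _ ⟨z, m, rfl⟩ ⟨w, hwy, hwz⟩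
  refine ⟨w, max n m, ?_⟩
  ext x
  constructor
  · rintro ⟨hxy, hxz⟩
    refine ⟨hxy.1.trans hwy.1.symm, fun i hi => ?_⟩
    rcases lt_max_iff.1 hi with h | h
    · exact (hxy.2 i h).trans (hwy.2 i h).symm
    · exact (hxz.2 i h).trans (hwz.2 i h).symm
  · rintro ⟨h1, h2⟩
    exact ⟨⟨h1.trans hwy.1, fun i hi => (h2 i (lt_max_of_lt_left hi)).trans (hwy.2 i hi)⟩,
      ⟨h1.trans hwz.1, fun i hi => (h2 i (lt_max_of_lt_right hi)).trans (hwz.2 i hi)⟩⟩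

theorem isBernoulliXN_iff {N : ℕ} {μ : Measure (Fin (2^N) × (ℕ → Bool))} :
    IsBernoulliXN N μ ↔
      ∀ y n, μ (cylXN y n) = ((2:ℝ≥0∞) ^ N)⁻¹ * ((2:ℝ≥0∞)⁻¹) ^ n := by
  constructor
  · intro h y n
    rw [← h y.1 n (fun i => y.2 i)]
    congr 1
    ext x
    simp [cylXN, Fin.forall_iff]
  · intro h p n u
    rw [← h (p, fun i => if hi : i < n then u ⟨i, hi⟩ else false) n]
    congr 1
    ext x
    simp +contextual [cylXN, Fin.forall_iff]

theorem IsBernoulliXN.isProbabilityMeasure {N : ℕ} {μ : Measure (Fin (2^N) × (ℕ → Bool))}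
    (h : IsBernoulliXN N μ) : IsProbabilityMeasure μ := by
  constructor
  have hU : (univ : Set (Fin (2^N) × (ℕ → Bool))) =
      ⋃ p : Fin (2^N), cylXN (p, fun _ => false) 0 := by
    ext x
    simp [cylXN]
  rw [hU, measure_iUnion _ fun p => measurableSet_cylXN _ _]
  · simp only [isBernoulliXN_iff.1 h, pow_zero, mul_one, tsum_fintype, Finset.sum_const,
      Finset.card_univ, Fintype.card_fin, nsmul_eq_mul]
    push_cast
    exact ENNReal.mul_inv_cancel (by simp) (by simp)
  · intro p p' hpp
    refine Set.disjoint_left.2 fun x hx hx' => hpp ?_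
    exact hx.1.symm.trans hx'.1

theorem IsBernoulliXN.unique {N : ℕ} {μ ν : Measure (Fin (2^N) × (ℕ → Bool))}
    (hμ : IsBernoulliXN N μ) (hν : IsBernoulliXN N ν) : μ = ν := by
  have := hμ.isProbabilityMeasure
  have := hν.isProbabilityMeasure
  refine ext_of_generate_finite _ ?_ (isPiSystem_cylXN N) ?_ (by simp)
  · rw [← (isTopologicalBasis_cylXN N).borel_eq_generateFrom]
    exact BorelSpace.measurable_eq
  · rintro _ ⟨y, n, rfl⟩
    rw [isBernoulliXN_iff.1 hμ, isBernoulliXN_iff.1 hν]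

section TreeAut

variable {N : ℕ} (e : (Fin (2^N) × (ℕ → Bool)) ≃ (Fin (2^N) × (ℕ → Bool)))

theorem preimage_cylXN_of_inducedByTreeAut (he : InducedByTreeAut N e)
    (he' : InducedByTreeAut N e.symm) (y : Fin (2^N) × (ℕ → Bool)) (n : ℕ) :
    e ⁻¹' cylXN y n = cylXN (e.symm y) n := by
  ext x
  constructor
  · intro hx
    simpa [cylXN] using he' n (e x) y hx.1 hx.2
  · intro hx
    simpa [cylXN] using he n x (e.symm y) hx.1 hx.2

theorem continuous_of_inducedByTreeAut (he : InducedByTreeAut N e)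
    (he' : InducedByTreeAut N e.symm) : Continuous e := by
  refine (isTopologicalBasis_cylXN N).continuous_iff.2 ?_
  rintro _ ⟨y, n, rfl⟩
  rw [preimage_cylXN_of_inducedByTreeAut e he he']
  exact (isTopologicalBasis_cylXN N).isOpen ⟨_, n, rfl⟩

theorem measurePreserving_of_inducedByTreeAut (he : InducedByTreeAut N e)
    (he' : InducedByTreeAut N e.symm) {μ : Measure (Fin (2^N) × (ℕ → Bool))}
    (hμ : IsBernoulliXN N μ) : MeasurePreserving e μ μ := by
  have hm : Measurable e := (continuous_of_inducedByTreeAut e he he').measurable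
  refine ⟨hm, IsBernoulliXN.unique (isBernoulliXN_iff.2 fun y n => ?_) hμ⟩
  rw [Measure.map_apply hm (measurableSet_cylXN y n),
    preimage_cylXN_of_inducedByTreeAut e he he', isBernoulliXN_iff.1 hμ]

end TreeAut

/-- The map on binary sequences flipping the coordinates up to and including
the first one different from `b`; for `b = true` this is the binary odometer. -/
def flipRun (b : Bool) (w : ℕ → Bool) (i : ℕ) : Bool :=
  open Classical in if ∀ j < i, w j = b then !(w i) else w i

theorem flipRun_eq_not_iff (b : Bool) (w : ℕ → Bool) (i : ℕ) :
    (∀ j < i, flipRun b w j = !b) ↔ ∀ j < i, w j = b := by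
  induction i with
  | zero => simp
  | succ i ih =>
    simp only [Nat.lt_succ_iff_lt_or_eq, or_imp, forall_and, forall_eq, ih]
    refine and_congr_right fun h => ?_
    simp [flipRun, if_pos h]

theorem flipRun_flipRun (b : Bool) (w : ℕ → Bool) : flipRun (!b) (flipRun b w) = w := by
  ext1 i
  rw [flipRun]
  simp only [flipRun_eq_not_iff]
  by_cases h : ∀ j < i, w j = b
  · rw [if_pos h, flipRun, if_pos h, Bool.not_not]
  · rw [if_neg h, flipRun, if_neg h]

theorem flipRun_congr (b : Bool) {w w' : ℕ → Bool} {n : ℕ} (h : ∀ i < n, w i = w' i) :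
    ∀ i < n, flipRun b w i = flipRun b w' i := by
  intro i hi
  have : (∀ j < i, w j = b) ↔ ∀ j < i, w' j = b :=
    forall₂_congr fun j hj => by rw [h j (hj.trans hi)]
  simp only [flipRun, this, h i hi]

/-- The skew map permuting the roots by `σ` and acting as the odometer on the subtree which
is sent to the root `0`. -/
def graftedOdometer {N : ℕ} (σ : Equiv.Perm (Fin (2^N))) :
    (Fin (2^N) × (ℕ → Bool)) ≃ (Fin (2^N) × (ℕ → Bool)) where
  toFun x := (σ x.1, if σ x.1 = 0 then flipRun true x.2 else x.2)
  invFun y := (σ.symm y.1, if y.1 = 0 then flipRun false y.2 else y.2)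
  left_inv x := by
    ext1
    · simp
    · by_cases h : σ x.1 = 0
      · simpa [h] using flipRun_flipRun true x.2
      · simp [h]
  right_inv y := by
    ext1
    · simp
    · by_cases h : y.1 = 0
      · simpa [h] using flipRun_flipRun false y.2
      · simp [h]

theorem graftedOdometer_inducedByTreeAut {N : ℕ} (σ : Equiv.Perm (Fin (2^N))) :
    InducedByTreeAut N (graftedOdometer σ) := by
  intro n x y h1 h2
  simp only [graftedOdometer, Equiv.coe_fn_mk, h1, true_and]
  split_ifs
  · exact flipRun_congr true h2
  · exact h2

theorem graftedOdometer_symm_inducedByTreeAut {N : ℕ} (σ : Equiv.Perm (Fin (2^N))) :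
    InducedByTreeAut N (graftedOdometer σ).symm := by
  intro n x y h1 h2
  simp only [graftedOdometer, Equiv.coe_fn_symm_mk, h1, true_and]
  split_ifs
  · exact flipRun_congr false h2
  · exact h2

/-- The reflection of each dyadic block `[2^j, 2^(j+1))`, fixing `0`. -/
def blockReflect (s : ℕ) : ℕ := if s = 0 then 0 else 3 * 2 ^ Nat.log 2 s - 1 - s

theorem blockReflect_eq {s j : ℕ} (h1 : 2 ^ j ≤ s) (h2 : s < 2 ^ (j + 1)) :
    blockReflect s = 3 * 2 ^ j - 1 - s := by
  have : 0 < 2 ^ j := Nat.two_pow_pos j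
  rw [blockReflect, if_neg (by omega), Nat.log_eq_of_pow_le_of_lt_pow h1 h2]

theorem exists_dyadic_block {s : ℕ} (hs : s ≠ 0) : ∃ j, 2 ^ j ≤ s ∧ s < 2 ^ (j + 1) :=
  ⟨Nat.log 2 s, Nat.pow_log_le_self 2 hs, Nat.lt_pow_succ_log_self one_lt_two s⟩

theorem blockReflect_involutive : Involutive blockReflect := by
  intro s
  by_cases hs : s = 0
  · simp [blockReflect, hs]
  · obtain ⟨j, h1, h2⟩ := exists_dyadic_block hs
    have h3 := blockReflect_eq h1 h2
    rw [blockReflect_eq (j := j)] <;> rw [pow_succ] at * <;> omega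

theorem blockReflect_lt {N s : ℕ} (h : s < 2 ^ N) : blockReflect s < 2 ^ N := by
  by_cases hs : s = 0
  · simp [blockReflect, hs]
  · obtain ⟨j, h1, h2⟩ := exists_dyadic_block hs
    have hj : 2 ^ (j + 1) ≤ 2 ^ N := by
      refine Nat.pow_le_pow_right two_pos ?_
      exact (Nat.pow_lt_pow_iff_right one_lt_two).1 (h1.trans_lt h)
    rw [blockReflect_eq h1 h2]
    rw [pow_succ] at *
    omega

/-- The permutation of the dyadic intervals of level `N` induced by the
von Neumann–Kakutani map. -/
def vnkPerm (N : ℕ) : Equiv.Perm (Fin (2^N)) :=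
  Fin.revPerm.trans <| Involutive.toPerm
    (fun s : Fin (2^N) => (⟨blockReflect s, blockReflect_lt s.2⟩ : Fin (2^N)))
    fun s => Fin.ext (blockReflect_involutive s)

theorem vnkPerm_val {N : ℕ} (p : Fin (2^N)) :
    (vnkPerm N p : ℕ) = blockReflect (2 ^ N - 1 - p) := by
  change blockReflect (p.rev : ℕ) = _
  rw [Fin.val_rev, Nat.sub_sub, add_comm]

theorem phiN_fst {N : ℕ} {x : ℝ} (hx : x ∈ Ico (0:ℝ) 1) :
    (((phiN N x).1 : ℕ) : ℤ) = ⌊(2:ℝ)^N * x⌋ := by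
  have h0 : 0 ≤ ⌊(2:ℝ)^N * x⌋ := Int.floor_nonneg.2 (mul_nonneg (by positivity) hx.1)
  have h1 : ⌊(2:ℝ)^N * x⌋ < (2 ^ N : ℕ) := by
    rw [Int.floor_lt]
    push_cast
    exact mul_lt_of_lt_one_right (by positivity) hx.2
  simp only [phiN]
  rw [Nat.mod_eq_of_lt (by omega)]
  omega

theorem floor_two_mul_ediv (y : ℝ) : ⌊2 * y⌋ / 2 = ⌊y⌋ := by
  have h1 : 2 * ⌊y⌋ ≤ ⌊2 * y⌋ := by
    rw [Int.le_floor]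
    push_cast
    linarith [Int.floor_le y]
  have h2 : ⌊2 * y⌋ < 2 * (⌊y⌋ + 1) := by
    rw [Int.floor_lt]
    push_cast
    linarith [Int.lt_floor_add_one y]
  omega

/-- The index of the dyadic interval of level `N + n` corresponding to the cylinder
of depth `n` around `y`. -/
def dyadicIndex {N : ℕ} (y : Fin (2^N) × (ℕ → Bool)) : ℕ → ℕ
  | 0 => y.1
  | n + 1 => 2 * dyadicIndex y n + (y.2 n).toNat

theorem dyadicIndex_lt {N : ℕ} (y : Fin (2^N) × (ℕ → Bool)) (n : ℕ) :
    dyadicIndex y n < 2 ^ (N + n) := by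
  induction n with
  | zero => exact y.1.2
  | succ n ih =>
    have := Bool.toNat_lt (y.2 n)
    rw [dyadicIndex, ← add_assoc, pow_succ]
    omega

theorem phiN_mem_cylXN_iff {N : ℕ} {x : ℝ} (hx : x ∈ Ico (0:ℝ) 1)
    (y : Fin (2^N) × (ℕ → Bool)) (n : ℕ) :
    phiN N x ∈ cylXN y n ↔ ⌊(2:ℝ)^(N + n) * x⌋ = dyadicIndex y n := by
  induction n with
  | zero => simp [cylXN, dyadicIndex, ← phiN_fst hx, Fin.ext_iff]
  | succ n ih =>
    have h1 : phiN N x ∈ cylXN y (n + 1) ↔ phiN N x ∈ cylXN y n ∧ (phiN N x).2 n = y.2 n := by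
      simp only [cylXN, mem_ofPred_eq, Nat.lt_succ_iff_lt_or_eq, or_imp, forall_and, forall_eq,
        and_assoc]
    have h2 : (2:ℝ)^(N + (n + 1)) * x = 2 * (2^(N + n) * x) := by ring
    have h3 := floor_two_mul_ediv ((2:ℝ)^(N + n) * x)
    rw [h1, ih, dyadicIndex]
    simp only [phiN]
    rw [add_assoc, h2]
    cases y.2 n <;> simp <;> omega

theorem phiN_injOn (N : ℕ) : InjOn (phiN N) (Ico (0:ℝ) 1) := by
  intro x hx y hy hxy
  have key (n : ℕ) : ⌊(2:ℝ)^(N + n) * x⌋ = ⌊(2:ℝ)^(N + n) * y⌋ := by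
    rw [(phiN_mem_cylXN_iff hx (phiN N x) n).1 (mem_cylXN_self _ n), hxy,
      (phiN_mem_cylXN_iff hy (phiN N y) n).1 (mem_cylXN_self _ n)]
  by_contra hne
  have hpos : 0 < |x - y| := abs_pos.2 (sub_ne_zero.2 hne)
  obtain ⟨n, hn⟩ := pow_unbounded_of_one_lt (1 / |x - y|) (one_lt_two (α := ℝ))
  have h1 := Int.abs_sub_lt_one_of_floor_eq_floor (key n)
  rw [← mul_sub, abs_mul, abs_of_pos (by positivity)] at h1
  rw [div_lt_iff₀ hpos] at hn
  have h2 : (2:ℝ) ^ n ≤ 2 ^ (N + n) := pow_le_pow_right₀ one_le_two (by omega)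
  nlinarith

theorem measurable_phiN (N : ℕ) : Measurable (phiN N) := by
  refine Measurable.prodMk ?_ (measurable_pi_lambda _ fun i => ?_)
  · exact (measurable_of_countable fun k : ℤ =>
      (⟨k.toNat % 2^N, Nat.mod_lt _ (Nat.two_pow_pos N)⟩ : Fin (2^N))).comp
      (Int.measurable_floor.comp (measurable_const_mul ((2:ℝ)^N)))
  · exact (measurable_of_countable fun k : ℤ => decide (k % 2 = 1)).comp
      (Int.measurable_floor.comp (measurable_const_mul ((2:ℝ)^(N + i + 1))))

theorem isBernoulliXN_map_phiN (N : ℕ) :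
    IsBernoulliXN N (Measure.map (phiN N) (volume.restrict (Ico (0:ℝ) 1))) := by
  refine isBernoulliXN_iff.2 fun y n => ?_
  have hK : (0:ℝ) < 2 ^ (N + n) := by positivity
  have hd : (dyadicIndex y n : ℝ) + 1 ≤ 2 ^ (N + n) := mod_cast dyadicIndex_lt y n
  have hset : phiN N ⁻¹' cylXN y n ∩ Ico (0:ℝ) 1 =
      Ico ((dyadicIndex y n : ℝ) / 2 ^ (N + n)) (((dyadicIndex y n : ℝ) + 1) / 2 ^ (N + n)) := by
    have hiff (x : ℝ) : ⌊(2:ℝ)^(N + n) * x⌋ = dyadicIndex y n ↔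
        x ∈ Ico ((dyadicIndex y n : ℝ) / 2 ^ (N + n))
          (((dyadicIndex y n : ℝ) + 1) / 2 ^ (N + n)) := by
      rw [Int.floor_eq_iff, mem_Ico, div_le_iff₀ hK, lt_div_iff₀ hK, mul_comm x]
      simp
    ext x
    constructor
    · rintro ⟨h1, h2⟩
      exact (hiff x).1 ((phiN_mem_cylXN_iff h2 y n).1 h1)
    · intro h
      have hx : x ∈ Ico (0:ℝ) 1 :=
        ⟨le_trans (by positivity) h.1, h.2.trans_le ((div_le_one hK).2 hd)⟩
      exact ⟨(phiN_mem_cylXN_iff hx y n).2 ((hiff x).2 h), hx⟩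
  rw [Measure.map_apply (measurable_phiN N) (measurableSet_cylXN y n),
    Measure.restrict_apply (measurable_phiN N (measurableSet_cylXN y n)), hset, Real.volume_Ico,
    ← sub_div, add_sub_cancel_left, one_div, ENNReal.ofReal_inv_of_pos hK,
    ENNReal.ofReal_pow zero_le_two, ENNReal.ofReal_ofNat, pow_add,
    ENNReal.mul_inv (by simp) (by simp), ENNReal.inv_pow (n := n)]

/-- The dyadic digits of a point of `[0,1)` and of its image under the
von Neumann–Kakutani map, where `m` is the number of leading digits `1` of the point. -/
theorem IsVNK.exists_floor {A : ℝ → ℝ} (hA : IsVNK A) {y : ℝ} (hy : y ∈ Ico (0:ℝ) 1) :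
    A y ∈ Ico (0:ℝ) 1 ∧ ∃ m : ℕ,
      (∀ k ≤ m, ⌊(2:ℝ)^k * y⌋ = 2^k - 1 ∧ ⌊(2:ℝ)^k * A y⌋ = 0) ∧
      ∀ c : ℕ, (2^(m + 1 + c) - 2^(c + 1) ≤ ⌊(2:ℝ)^(m + 1 + c) * y⌋ ∧
        ⌊(2:ℝ)^(m + 1 + c) * y⌋ < 2^(m + 1 + c) - 2^c) ∧
        ⌊(2:ℝ)^(m + 1 + c) * A y⌋ = ⌊(2:ℝ)^(m + 1 + c) * y⌋ + (3 * 2^c - 2^(m + 1 + c)) := by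
  obtain ⟨m, hm1, hm2⟩ := exists_nat_pow_near_of_lt_one (x := 1 - y) (y := (2⁻¹ : ℝ))
    (by linarith [hy.2]) (by linarith [hy.1]) (by norm_num) (by norm_num)
  have hz : (2:ℝ) ^ (-((m + 1 : ℕ) : ℤ)) = 2⁻¹ ^ (m + 1) := by
    rw [zpow_neg, zpow_natCast, inv_pow]
  have hz' : (2:ℝ) ^ (1 - ((m + 1 : ℕ) : ℤ)) = 2⁻¹ ^ m := by
    rw [show 1 - ((m + 1 : ℕ) : ℤ) = -(m : ℤ) by push_cast; ring, zpow_neg, zpow_natCast, inv_pow]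
  have hAy := hA (m + 1) (by omega) y ⟨by rw [hz']; linarith, by rw [hz]; linarith⟩
  rw [hz] at hAy
  have hpos : (0:ℝ) < 2⁻¹ ^ m := by positivity
  have hle : (2⁻¹:ℝ) ^ m ≤ 1 := pow_le_one₀ (by norm_num) (by norm_num)
  have hscale (c : ℕ) : (2:ℝ)^(m + 1 + c) * 2⁻¹ ^ (m + 1) = 2 ^ c := by
    rw [pow_add, mul_right_comm, ← mul_pow]
    simp
  rw [pow_succ] at hm1 hAy
  refine ⟨⟨by linarith, by linarith⟩, m, fun k hk => ?_, fun c => ⟨⟨?_, ?_⟩, ?_⟩⟩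
  · have hk0 : (0:ℝ) < 2 ^ k := by positivity
    have hkm : (2:ℝ) ^ k * 2⁻¹ ^ m ≤ 1 := by
      calc (2:ℝ) ^ k * 2⁻¹ ^ m ≤ 2 ^ m * 2⁻¹ ^ m := by
            gcongr
            exact one_le_two
        _ = 1 := by rw [← mul_pow]; simp
    constructor <;> rw [Int.floor_eq_iff] <;> push_cast <;> constructor <;> nlinarith [hy.1, hy.2]
  · have := hscale c
    rw [Int.le_floor]
    rw [pow_succ] at this
    push_cast
    have h2 : (2:ℝ)^(m + 1 + c) * (1 - y) ≤ 2^(m + 1 + c) * 2⁻¹ ^ m := by gcongr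
    rw [pow_succ 2 c]
    linarith
  · have := hscale c
    rw [Int.floor_lt]
    rw [pow_succ] at this
    push_cast
    have h2 : (2:ℝ)^(m + 1 + c) * (2⁻¹ ^ m * 2⁻¹) < 2^(m + 1 + c) * (1 - y) := by gcongr
    linarith
  · rw [← Int.floor_add_intCast, hAy]
    congr 1
    have := hscale c
    rw [pow_succ] at this
    push_cast
    linear_combination 3 * this

theorem phiN_vnk {N : ℕ} {A : ℝ → ℝ} (hA : IsVNK A) {y : ℝ} (hy : y ∈ Ico (0:ℝ) 1) :
    phiN N (A y) = graftedOdometer (vnkPerm N) (phiN N y) := by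
  obtain ⟨hAy, m, hm, hc⟩ := hA.exists_floor hy
  have hfst := phiN_fst (N := N) hy
  have hfst' := phiN_fst (N := N) hAy
  have hlt := (phiN N y).1.2
  have hval := vnkPerm_val (phiN N y).1
  have heven {k c : ℕ} (hk : k = m + 1 + (c + 1)) :
      ⌊(2:ℝ)^k * A y⌋ % 2 = ⌊(2:ℝ)^k * y⌋ % 2 := by
    subst hk
    rw [(hc (c + 1)).2, pow_succ, ← add_assoc, pow_succ]
    omega
  rcases lt_or_ge m N with hmN | hmN
  · obtain ⟨j, hj⟩ := Nat.exists_eq_add_of_le (Nat.succ_le_of_lt hmN)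
    obtain ⟨⟨hj1, hj2⟩, hj3⟩ := hc j
    rw [← Nat.succ_eq_add_one m, ← hj] at hj1 hj2 hj3
    rw [← hfst] at hj1 hj2
    rw [← hfst, ← hfst'] at hj3
    have hj0 : 0 < 2 ^ j := Nat.two_pow_pos j
    have hN : ((2 ^ N : ℕ) : ℤ) = 2 ^ N := by push_cast; rfl
    have hJ : ((2 ^ j : ℕ) : ℤ) = 2 ^ j := by push_cast; rfl
    rw [pow_succ, ← hN, ← hJ] at hj1
    rw [← hN, ← hJ] at hj2 hj3
    rw [blockReflect_eq (j := j) (by omega) (by rw [pow_succ]; omega)] at hval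
    have hp : vnkPerm N (phiN N y).1 = (phiN N (A y)).1 := Fin.ext (by omega)
    have hp0 : vnkPerm N (phiN N y).1 ≠ 0 := by
      intro h
      rw [h, Fin.val_zero] at hval
      omega
    refine Prod.ext hp.symm ?_
    simp only [graftedOdometer, Equiv.coe_fn_mk, if_neg hp0]
    funext i
    simp only [phiN]
    rw [heven (c := j + i) (by omega)]
  · obtain ⟨hN1, hN2⟩ := hm N hmN
    rw [← hfst] at hN1
    rw [← hfst'] at hN2
    have hN : ((2 ^ N : ℕ) : ℤ) = 2 ^ N := by push_cast; rfl
    rw [← hN] at hN1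
    rw [show 2 ^ N - 1 - ((phiN N y).1 : ℕ) = 0 by omega, blockReflect, if_pos rfl] at hval
    have hp0 : vnkPerm N (phiN N y).1 = 0 := Fin.ext (by simpa using hval)
    refine Prod.ext ?_ ?_
    · refine Fin.ext ?_
      simp only [graftedOdometer, Equiv.coe_fn_mk]
      omega
    simp only [graftedOdometer, Equiv.coe_fn_mk, if_pos hp0]
    have hone {i : ℕ} (hi : N + i + 1 ≤ m) :
        (phiN N y).2 i = true ∧ (phiN N (A y)).2 i = false := by
      obtain ⟨h1, h2⟩ := hm _ hi
      simp only [phiN, h1, h2, decide_eq_true_iff, decide_eq_false_iff_not]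
      rw [pow_succ]
      omega
    have hzero {i : ℕ} (hi : N + i + 1 = m + 1) :
        (phiN N y).2 i = false ∧ (phiN N (A y)).2 i = true := by
      obtain ⟨⟨h1, h2⟩, h3⟩ := hc 0
      simp only [add_zero, ← hi, pow_succ] at h1 h2 h3
      simp only [phiN, pow_succ, decide_eq_true_iff, decide_eq_false_iff_not]
      omega
    funext i
    rcases lt_trichotomy (N + i) m with h | h | h
    · rw [flipRun, if_pos fun k hk => (hone (by omega)).1, (hone h).1, (hone h).2, Bool.not_true]
    · rw [flipRun, if_pos fun k hk => (hone (by omega)).1, (hzero (by omega)).1,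
        (hzero (by omega)).2, Bool.not_false]
    · have hnot : ¬ ∀ k < i, (phiN N y).2 k = true := fun hall => by
        have := hall (m - N) (by omega)
        rw [(hzero (by omega)).1] at this
        exact Bool.false_ne_true this
      rw [flipRun, if_neg hnot]
      simp only [phiN]
      rw [heven (c := N + i - m - 1) (by omega)]

theorem phiN_iet {N : ℕ} {π : Equiv.Perm (Fin (2^N))} {R : ℝ → ℝ} (hR : IsIET (2^N) π R)
    {x : ℝ} (hx : x ∈ Ico (0:ℝ) 1) :
    R x ∈ Ico (0:ℝ) 1 ∧ phiN N (R x) = (π (phiN N x).1, (phiN N x).2) := by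
  set p := (phiN N x).1 with hp
  have hfst := phiN_fst (N := N) hx
  rw [← hp] at hfst
  have hq : (0:ℝ) < 2 ^ N := by positivity
  have hfl := Int.floor_eq_iff.1 hfst.symm
  push_cast at hfl
  have hRx := hR p x (by
    push_cast
    rw [mem_Ico, div_le_iff₀ hq, lt_div_iff₀ hq, mul_comm x]
    exact hfl)
  push_cast at hRx
  have hRx' : (2:ℝ)^N * R x = 2^N * x + ((π p : ℕ) - (p : ℕ)) := by
    rw [hRx]
    field_simp
  have hπ : ((π p : ℕ) : ℝ) + 1 ≤ 2^N := mod_cast (π p).2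
  have hmem : R x ∈ Ico (0:ℝ) 1 := by
    constructor
    · refine nonneg_of_mul_nonneg_right (a := (2:ℝ)^N) ?_ hq
      rw [hRx']
      linarith [(Nat.cast_nonneg (π p : ℕ) : (0:ℝ) ≤ _)]
    · refine lt_of_mul_lt_mul_left (a := (2:ℝ)^N) ?_ hq.le
      rw [hRx']
      linarith
  refine ⟨hmem, Prod.ext (Fin.ext ?_) (funext fun i => ?_)⟩
  · zify
    rw [phiN_fst hmem, hRx', Int.floor_eq_iff]
    push_cast
    constructor <;> linarith
  · have h : (2:ℝ)^(N + i + 1) * R x =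
        2^(N + i + 1) * x + ((2 * (2^i * ((π p : ℕ) - (p : ℕ))) : ℤ) : ℝ) := by
      push_cast
      rw [pow_succ, pow_add]
      linear_combination 2 * 2 ^ i * hRx'
    simp only [phiN]
    rw [h, Int.floor_add_intCast, Int.add_mul_emod_self_left]

/-- for `q = 2^N` and a permutation `π` of `{0,…,q-1}`, the map `φ_N` is
injective and measurable on `[0,1)`, pushes Lebesgue measure forward to `μ_N`, has
`μ_N`-conull image, and conjugates the rotated odometer `F_π = ā ∘ R_π` to a
`μ_N`-preserving homeomorphism of `X_N` induced by an automorphism of the grafted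
binary tree `T_N`. -/
theorem stmt0 (N : ℕ) (hN : 1 ≤ N) (π : Equiv.Perm (Fin (2^N)))
    (A R F : ℝ → ℝ) (hA : IsVNK A) (hR : IsIET (2^N) π R) (hF : ∀ x, F x = A (R x))
    (μN : Measure (Fin (2^N) × (ℕ → Bool))) (hμN : IsBernoulliXN N μN) :
    Set.InjOn (phiN N) (Set.Ico (0:ℝ) 1) ∧
    Measurable (phiN N) ∧
    Measure.map (phiN N) (volume.restrict (Set.Ico (0:ℝ) 1)) = μN ∧
    μN ((phiN N '' Set.Ico (0:ℝ) 1)ᶜ) = 0 ∧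
    ∃ G : (Fin (2^N) × (ℕ → Bool)) ≃ₜ (Fin (2^N) × (ℕ → Bool)),
      InducedByTreeAut N ⇑G ∧
      MeasurePreserving ⇑G μN μN ∧
      ∀ x ∈ Set.Ico (0:ℝ) 1, G (phiN N x) = phiN N (F x) := by
  have hmap : Measure.map (phiN N) (volume.restrict (Ico (0:ℝ) 1)) = μN :=
    (isBernoulliXN_map_phiN N).unique hμN
  refine ⟨phiN_injOn N, measurable_phiN N, hmap, ?_, ?_⟩
  · have hS : MeasurableSet (phiN N '' Ico (0:ℝ) 1) :=
      measurableSet_Ico.image_of_measurable_injOn (measurable_phiN N) (phiN_injOn N)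
    rw [← hmap, Measure.map_apply (measurable_phiN N) hS.compl,
      Measure.restrict_apply (measurable_phiN N hS.compl)]
    convert measure_empty (μ := (volume : Measure ℝ))
    refine eq_empty_iff_forall_notMem.2 ?_
    rintro x ⟨hx, hx'⟩
    exact hx (mem_image_of_mem _ hx')
  · have he := graftedOdometer_inducedByTreeAut (π.trans (vnkPerm N))
    have he' := graftedOdometer_symm_inducedByTreeAut (π.trans (vnkPerm N))
    refine ⟨⟨graftedOdometer (π.trans (vnkPerm N)), continuous_of_inducedByTreeAut _ he he',
      continuous_of_inducedByTreeAut _ he' he⟩, he,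
      measurePreserving_of_inducedByTreeAut _ he he' hμN, fun x hx => ?_⟩
    obtain ⟨hRx, hphi⟩ := phiN_iet hR hx
    rw [hF, phiN_vnk hA hRx, hphi]
    rfl
end
end

section
/- Let N ≥ 1, q = 2^N, and let π be a permutation of {0,…,q−1}. Then the set I_per of periodic points of the rotated odometer F_π is a finite (possibly empty) union of pairwise disjoint half-open intervals [x,y) ⊆ [0,1), and the set of minimal periods of points of I_per under F_π is finite. -/
open MeasureTheory Set Function
open scoped ENNReal

noncomputable section

/-- The point with offset `y` in the `p`-th interval of the partition of `[0,1)` into `2^N`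
intervals of equal length. -/
def dyadicPoint (N : ℕ) (p : ℕ) (y : ℝ) : ℝ := (p + y) / 2 ^ N

lemma dyadicPoint_mem (N : ℕ) (p : Fin (2 ^ N)) {y : ℝ} (hy : y ∈ Ico (0:ℝ) 1) :
    dyadicPoint N p y ∈ Ico ((p : ℝ) / 2 ^ N) (((p : ℝ) + 1) / 2 ^ N) := by
  unfold dyadicPoint
  constructor
  · gcongr; linarith [hy.1]
  · gcongr; exact hy.2

lemma exists_dyadicPoint_eq_of_mem (N p : ℕ) {x : ℝ}
    (hx : x ∈ Ico ((p : ℝ) / 2 ^ N) (((p : ℝ) + 1) / 2 ^ N)) :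
    ∃ y ∈ Ico (0:ℝ) 1, dyadicPoint N p y = x := by
  have hq : (0:ℝ) < 2 ^ N := by positivity
  obtain ⟨h1, h2⟩ := hx
  rw [div_le_iff₀ hq] at h1
  rw [lt_div_iff₀ hq] at h2
  refine ⟨x * 2 ^ N - p, ⟨by linarith, by linarith⟩, ?_⟩
  unfold dyadicPoint
  field_simp
  ring

lemma exists_mem_dyadic (N : ℕ) {x : ℝ} (hx : x ∈ Ico (0:ℝ) 1) :
    ∃ p : Fin (2 ^ N), x ∈ Ico ((p : ℝ) / 2 ^ N) (((p : ℝ) + 1) / 2 ^ N) := by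
  have hq : (0:ℝ) < 2 ^ N := by positivity
  have h0 : 0 ≤ x * 2 ^ N := mul_nonneg hx.1 hq.le
  refine ⟨⟨⌊x * 2 ^ N⌋₊, ?_⟩, ?_, ?_⟩
  · rw [Nat.floor_lt h0]
    push_cast
    nlinarith [hx.2]
  · rw [div_le_iff₀ hq]
    exact Nat.floor_le h0
  · rw [lt_div_iff₀ hq]
    exact Nat.lt_floor_add_one _

lemma dyadicPoint_fst_inj {N p p' : ℕ} {y y' : ℝ} (hy : y ∈ Ico (0:ℝ) 1)
    (hy' : y' ∈ Ico (0:ℝ) 1) (h : dyadicPoint N p y = dyadicPoint N p' y') : p = p' := by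
  unfold dyadicPoint at h
  rw [div_left_inj' (by positivity)] at h
  have h1 : (p : ℝ) < p' + 1 := by linarith [hy.1, hy'.2]
  have h2 : (p' : ℝ) < p + 1 := by linarith [hy.2, hy'.1]
  norm_cast at h1 h2
  omega

lemma dyadicPoint_snd_inj {N p : ℕ} {y y' : ℝ} (h : dyadicPoint N p y = dyadicPoint N p y') :
    y = y' := by
  unfold dyadicPoint at h
  rw [div_left_inj' (by positivity)] at h
  linarith

namespace IsVNK

lemma apply_of_mem {A : ℝ → ℝ} (hA : IsVNK A) (n : ℕ) {x : ℝ} (h1 : 1 - (1/2 : ℝ) ^ n ≤ x)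
    (h2 : x < 1 - (1/2 : ℝ) ^ (n + 1)) : A x = x - 1 + 3 * (1/2 : ℝ) ^ (n + 1) := by
  have e1 : (2:ℝ) ^ (1 - ((n + 1 : ℕ) : ℤ)) = (1/2 : ℝ) ^ n := by
    rw [show (1 - ((n + 1 : ℕ) : ℤ)) = -(n : ℤ) by push_cast; ring]
    simp
  have e2 : (2:ℝ) ^ (-((n + 1 : ℕ) : ℤ)) = (1/2 : ℝ) ^ (n + 1) := by
    rw [zpow_neg, zpow_natCast]
    simp
  rw [hA (n + 1) (by omega) x (by rw [e1, e2]; exact ⟨h1, h2⟩), e2]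
  ring

lemma exists_level {x : ℝ} (hx : x ∈ Ico (0:ℝ) 1) :
    ∃ n : ℕ, 1 - (1/2 : ℝ) ^ n ≤ x ∧ x < 1 - (1/2 : ℝ) ^ (n + 1) := by
  obtain ⟨n, h1, h2⟩ := exists_nat_pow_near_of_lt_one (x := 1 - x) (y := (1/2 : ℝ))
    (by linarith [hx.2]) (by linarith [hx.1]) (by norm_num) (by norm_num)
  exact ⟨n, by linarith, by linarith⟩

lemma apply_mem {A : ℝ → ℝ} (hA : IsVNK A) {x : ℝ} (hx : x ∈ Ico (0:ℝ) 1) : A x ∈ Ico (0:ℝ) 1 := by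
  obtain ⟨n, h1, h2⟩ := exists_level hx
  rw [hA.apply_of_mem n h1 h2]
  have h3 : (1/2 : ℝ) ^ n ≤ 1 := pow_le_one₀ (by norm_num) (by norm_num)
  have h4 : (0:ℝ) < (1/2 : ℝ) ^ n := by positivity
  rw [pow_succ] at *
  constructor <;> linarith

lemma iterate_mem {A : ℝ → ℝ} (hA : IsVNK A) {x : ℝ} (hx : x ∈ Ico (0:ℝ) 1) (m : ℕ) : A^[m] x ∈ Ico (0:ℝ) 1 :=
  MapsTo.iterate (fun _ h => hA.apply_mem h) m hx

/-- On the last dyadic interval, `A` is a rescaled copy of itself. -/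
lemma apply_last {A : ℝ → ℝ} (hA : IsVNK A) (N : ℕ) {y : ℝ} (hy : y ∈ Ico (0:ℝ) 1) :
    A ((2 ^ N - 1 + y) / 2 ^ N) = A y / 2 ^ N := by
  obtain ⟨n, h1, h2⟩ := exists_level hy
  have hq : (0:ℝ) < 2 ^ N := by positivity
  have e : ∀ k : ℕ, (1/2 : ℝ) ^ (k + N) * 2 ^ N = (1/2 : ℝ) ^ k := fun k => by
    rw [pow_add, mul_assoc, ← mul_pow]; norm_num
  have e' := e (n + 1)
  have e0 := e n
  rw [show n + 1 + N = n + N + 1 by ring] at e'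
  rw [hA.apply_of_mem (n + N), hA.apply_of_mem n h1 h2]
  · rw [eq_div_iff hq.ne', add_mul, sub_mul, div_mul_cancel₀ _ hq.ne', mul_assoc, e']
    ring
  · rw [le_div_iff₀ hq]; linarith
  · rw [div_lt_iff₀ hq]; linarith

/-- Outside the last dyadic interval, `A` translates dyadic intervals; the intervals are counted
from the right. -/
lemma apply_of_ne_last {A : ℝ → ℝ} (hA : IsVNK A) (N : ℕ) {c : ℕ} (hc : 1 ≤ c) (hcN : c < 2 ^ N) {y : ℝ}
    (hy : y ∈ Ico (0:ℝ) 1) :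
    A ((2 ^ N - 1 - c + y) / 2 ^ N) = (3 * 2 ^ Nat.log 2 c - 1 - c + y) / 2 ^ N := by
  have hq : (0:ℝ) < 2 ^ N := by positivity
  set L := Nat.log 2 c with hL
  have h1 : (2:ℝ) ^ L ≤ c := by exact_mod_cast Nat.pow_log_le_self 2 (by omega)
  have h2 : (c:ℝ) + 1 ≤ 2 ^ L * 2 := by
    exact_mod_cast Nat.lt_pow_succ_log_self (b := 2) (by norm_num) c
  have hLN : L < N := Nat.log_lt_of_lt_pow (by omega) hcN
  obtain ⟨n, rfl⟩ : ∃ n, N = L + n + 1 := ⟨N - L - 1, by omega⟩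
  have e : (1/2 : ℝ) ^ (n + 1) * 2 ^ (L + n + 1) = 2 ^ L := by
    rw [add_assoc, pow_add 2, mul_left_comm, ← mul_pow]; norm_num
  have e' : (1/2 : ℝ) ^ n * 2 ^ (L + n + 1) = 2 ^ L * 2 := by
    rw [← e, pow_succ (1/2 : ℝ) n]; ring
  rw [hA.apply_of_mem n]
  · rw [eq_div_iff hq.ne', add_mul, sub_mul, div_mul_cancel₀ _ hq.ne', mul_assoc, e]
    ring
  · rw [le_div_iff₀ hq]; linarith [hy.1]
  · rw [div_lt_iff₀ hq]; linarith [hy.2]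

lemma apply_left_half {A : ℝ → ℝ} (hA : IsVNK A) {y : ℝ} (hy : y ∈ Ico (0:ℝ) 1) : A (y / 2) = (1 + y) / 2 := by
  rw [hA.apply_of_mem 0] <;> norm_num <;> linarith [hy.1, hy.2]

lemma apply_right_half {A : ℝ → ℝ} (hA : IsVNK A) {y : ℝ} (hy : y ∈ Ico (0:ℝ) 1) : A ((1 + y) / 2) = A y / 2 := by
  have := hA.apply_last 1 hy
  norm_num at this
  exact this

lemma iterate_two_mul_left_half {A : ℝ → ℝ} (hA : IsVNK A) {y : ℝ} (hy : y ∈ Ico (0:ℝ) 1) (k : ℕ) :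
    A^[2 * k] (y / 2) = A^[k] y / 2 := by
  induction k with
  | zero => rfl
  | succ k ih =>
    have hk := hA.iterate_mem hy k
    rw [show 2 * (k + 1) = 2 * k + 1 + 1 by ring, iterate_succ_apply', iterate_succ_apply', ih,
      hA.apply_left_half hk, hA.apply_right_half hk, iterate_succ_apply']

lemma iterate_two_mul_right_half {A : ℝ → ℝ} (hA : IsVNK A) {y : ℝ} (hy : y ∈ Ico (0:ℝ) 1) (k : ℕ) :
    A^[2 * k] ((1 + y) / 2) = (1 + A^[k] y) / 2 := by
  rw [← hA.apply_left_half hy, ← iterate_succ_apply, iterate_succ_apply',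
    hA.iterate_two_mul_left_half hy, hA.apply_left_half (hA.iterate_mem hy k)]

/-- The von Neumann–Kakutani map has no periodic points. -/
lemma iterate_ne_self {A : ℝ → ℝ} (hA : IsVNK A) (m : ℕ) (hm : 1 ≤ m) {x : ℝ} (hx : x ∈ Ico (0:ℝ) 1) : A^[m] x ≠ x := by
  induction m using Nat.strong_induction_on generalizing x with
  | _ m ih =>
    intro h
    obtain hlt | hge := lt_or_ge x (1/2)
    · obtain ⟨y, rfl⟩ : ∃ y, x = y / 2 := ⟨2 * x, by ring⟩
      have hy : y ∈ Ico (0:ℝ) 1 := ⟨by linarith [hx.1], by linarith⟩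
      obtain ⟨k, rfl | rfl⟩ := Nat.even_or_odd' m
      · rw [hA.iterate_two_mul_left_half hy] at h
        exact ih k (by omega) (by omega) hy (by linarith)
      · have hk := hA.iterate_mem hy k
        rw [iterate_succ_apply', hA.iterate_two_mul_left_half hy, hA.apply_left_half hk] at h
        linarith [hk.1]
    · obtain ⟨y, rfl⟩ : ∃ y, x = (1 + y) / 2 := ⟨2 * x - 1, by ring⟩
      have hy : y ∈ Ico (0:ℝ) 1 := ⟨by linarith, by linarith [hx.2]⟩
      obtain ⟨k, rfl | rfl⟩ := Nat.even_or_odd' m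
      · rw [hA.iterate_two_mul_right_half hy] at h
        exact ih k (by omega) (by omega) hy (by linarith)
      · have hk := hA.iterate_mem hy k
        rw [iterate_succ_apply', hA.iterate_two_mul_right_half hy, hA.apply_right_half hk] at h
        linarith [(hA.apply_mem hk).2]

end IsVNK

/-- The involution of `ℕ` fixing `0` and reversing each block `[2^L, 2^(L+1))`. -/
def dyadicFlip (c : ℕ) : ℕ := if c = 0 then 0 else 3 * 2 ^ Nat.log 2 c - 1 - c

lemma dyadicFlip_bounds {c : ℕ} (hc : c ≠ 0) :
    2 ^ Nat.log 2 c ≤ dyadicFlip c ∧ dyadicFlip c < 2 ^ (Nat.log 2 c + 1) ∧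
      dyadicFlip c + c + 1 = 3 * 2 ^ Nat.log 2 c := by
  have h1 := Nat.pow_log_le_self 2 hc
  have h2 := Nat.lt_pow_succ_log_self (b := 2) (by norm_num) c
  rw [Nat.succ_eq_add_one] at h2
  rw [pow_succ] at *
  unfold dyadicFlip
  rw [if_neg hc]
  omega

lemma log_dyadicFlip (c : ℕ) : Nat.log 2 (dyadicFlip c) = Nat.log 2 c := by
  obtain rfl | hc := eq_or_ne c 0
  · simp [dyadicFlip]
  · obtain ⟨h1, h2, -⟩ := dyadicFlip_bounds hc
    exact Nat.log_eq_of_pow_le_of_lt_pow h1 h2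

lemma dyadicFlip_involutive : Involutive dyadicFlip := by
  intro c
  obtain rfl | hc := eq_or_ne c 0
  · simp [dyadicFlip]
  · obtain ⟨h1, -, h3⟩ := dyadicFlip_bounds hc
    have hc' : dyadicFlip c ≠ 0 := by
      have : 0 < 2 ^ Nat.log 2 c := by positivity
      omega
    obtain ⟨-, -, h3'⟩ := dyadicFlip_bounds hc'
    rw [log_dyadicFlip] at h3'
    omega

lemma dyadicFlip_lt {N c : ℕ} (hc : c < 2 ^ N) : dyadicFlip c < 2 ^ N := by
  obtain rfl | h0 := eq_or_ne c 0
  · simp [dyadicFlip]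
  · exact (dyadicFlip_bounds h0).2.1.trans_le
      (Nat.pow_le_pow_right (by norm_num) (Nat.log_lt_of_lt_pow h0 hc))

/-- The permutation of the dyadic intervals of level `N` induced by the von Neumann–Kakutani
map. -/
def odometerPerm (N : ℕ) : Equiv.Perm (Fin (2 ^ N)) :=
  Fin.revPerm.trans (Involutive.toPerm (fun c => ⟨dyadicFlip c, dyadicFlip_lt c.isLt⟩)
    fun c => Fin.ext (dyadicFlip_involutive c))

lemma odometerPerm_val (N : ℕ) (p : Fin (2 ^ N)) :
    (odometerPerm N p : ℕ) = dyadicFlip (2 ^ N - 1 - p) := by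
  have : 2 ^ N - 1 - (p : ℕ) = 2 ^ N - (p + 1) := by omega
  change dyadicFlip (Fin.rev p : ℕ) = _
  rw [Fin.val_rev, this]

lemma IsVNK.apply_dyadicPoint {A : ℝ → ℝ} (hA : IsVNK A) (N : ℕ) (p : Fin (2 ^ N)) {y : ℝ}
    (hy : y ∈ Ico (0:ℝ) 1) :
    A (dyadicPoint N p y) =
      dyadicPoint N (odometerPerm N p) (if (p : ℕ) + 1 = 2 ^ N then A y else y) := by
  rw [odometerPerm_val]
  have hp := p.isLt
  obtain ⟨c, hc⟩ : ∃ c, (p : ℕ) + 1 + c = 2 ^ N := ⟨2 ^ N - (p + 1), by omega⟩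
  have hcr : (p : ℝ) = 2 ^ N - 1 - c := by
    have : ((p : ℕ) : ℝ) + 1 + c = 2 ^ N := by exact_mod_cast hc
    linarith
  rw [show 2 ^ N - 1 - (p : ℕ) = c by omega]
  unfold dyadicPoint
  rw [hcr]
  obtain rfl | h0 := eq_or_ne c 0
  · rw [if_pos (by omega)]
    simpa [dyadicFlip] using hA.apply_last N hy
  · rw [if_neg (by omega), hA.apply_of_ne_last N (by omega) (by omega) hy]
    have h : ((dyadicFlip c : ℕ) : ℝ) + c + 1 = 3 * 2 ^ Nat.log 2 c := by
      exact_mod_cast (dyadicFlip_bounds h0).2.2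
    congr 1
    linarith

lemma IsIET.apply_dyadicPoint {N : ℕ} {π : Equiv.Perm (Fin (2 ^ N))} {R : ℝ → ℝ}
    (hR : IsIET (2 ^ N) π R) (p : Fin (2 ^ N)) {y : ℝ} (hy : y ∈ Ico (0:ℝ) 1) :
    R (dyadicPoint N p y) = dyadicPoint N (π p) y := by
  have h := dyadicPoint_mem N p hy
  rw [hR p _ (by push_cast; exact h)]
  unfold dyadicPoint
  push_cast
  ring

section RotatedOdometer

variable {N : ℕ} {π : Equiv.Perm (Fin (2 ^ N))} {A R F : ℝ → ℝ}

lemma iterate_rotatedOdometer (hA : IsVNK A) (hR : IsIET (2 ^ N) π R) (hF : ∀ x, F x = A (R x))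
    (p : Fin (2 ^ N)) {y : ℝ} (hy : y ∈ Ico (0:ℝ) 1) (k : ℕ) :
    ∃ m, F^[k] (dyadicPoint N p y) =
        dyadicPoint N (((π.trans (odometerPerm N)) ^ k) p) (A^[m] y) ∧
      ((∃ j < k, (π (((π.trans (odometerPerm N)) ^ j) p) : ℕ) + 1 = 2 ^ N) ↔ 1 ≤ m) := by
  induction k with
  | zero => exact ⟨0, rfl, by simp⟩
  | succ k ih =>
    obtain ⟨m, h1, h2⟩ := ih
    have hm := hA.iterate_mem hy m
    rw [iterate_succ_apply', h1, hF, hR.apply_dyadicPoint _ hm, hA.apply_dyadicPoint _ _ hm,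
      pow_succ', Equiv.Perm.mul_apply, Equiv.trans_apply, Nat.exists_lt_succ_right, h2]
    split_ifs with h
    · exact ⟨m + 1, by rw [iterate_succ_apply'], by simp [h]⟩
    · exact ⟨m, rfl, by simp [h]⟩

/-- A point is periodic iff the orbit of the dyadic interval containing it avoids the interval
that the interval exchange sends to the last one. -/
lemma dyadicPoint_periodic (hA : IsVNK A) (hR : IsIET (2 ^ N) π R) (hF : ∀ x, F x = A (R x))
    (p : Fin (2 ^ N)) {y : ℝ} (hy : y ∈ Ico (0:ℝ) 1) :
    (¬ (∃ j < orderOf (π.trans (odometerPerm N)),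
        (π (((π.trans (odometerPerm N)) ^ j) p) : ℕ) + 1 = 2 ^ N) →
      IsPeriodicPt F (orderOf (π.trans (odometerPerm N))) (dyadicPoint N p y)) ∧
    ((∃ j < orderOf (π.trans (odometerPerm N)),
        (π (((π.trans (odometerPerm N)) ^ j) p) : ℕ) + 1 = 2 ^ N) →
      ∀ k, 1 ≤ k → ¬ IsPeriodicPt F k (dyadicPoint N p y)) := by
  set K := orderOf (π.trans (odometerPerm N)) with hK
  constructor
  · intro hgood
    obtain ⟨m, h1, h2⟩ := iterate_rotatedOdometer hA hR hF p hy K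
    obtain rfl : m = 0 := by
      by_contra h
      exact hgood (h2.2 (by omega))
    rw [IsPeriodicPt, IsFixedPt, h1, hK, pow_orderOf_eq_one]
    rfl
  · rintro ⟨j, hj, hjp⟩ k hk hper
    obtain ⟨m, h1, h2⟩ := iterate_rotatedOdometer hA hR hF p hy (K * k)
    have hm : 1 ≤ m := h2.1 ⟨j, hj.trans_le (Nat.le_mul_of_pos_right K hk), hjp⟩
    rw [(hper.const_mul K).eq, pow_mul, hK, pow_orderOf_eq_one, one_pow] at h1
    exact hA.iterate_ne_self m hm hy (dyadicPoint_snd_inj h1).symm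

end RotatedOdometer

/-- for `q = 2^N` the set of periodic points of the rotated odometer
`F_π = ā ∘ R_π` is a finite (possibly empty) union of pairwise disjoint half-open
intervals `[x,y) ⊆ [0,1)`, and the set of minimal periods of its points is finite. -/
theorem stmt1 (N : ℕ) (hN : 1 ≤ N) (π : Equiv.Perm (Fin (2^N)))
    (A R F : ℝ → ℝ) (hA : IsVNK A) (hR : IsIET (2^N) π R) (hF : ∀ x, F x = A (R x)) :
    (∃ (n : ℕ) (e : Fin n → ℝ × ℝ),
      Iper F = ⋃ i, Set.Ico (e i).1 (e i).2 ∧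
      (∀ i, Set.Ico (e i).1 (e i).2 ⊆ Set.Ico (0:ℝ) 1) ∧
      Pairwise fun i j => Disjoint (Set.Ico (e i).1 (e i).2) (Set.Ico (e j).1 (e j).2)) ∧
    Set.Finite (Function.minimalPeriod F '' Iper F) := by
  classical
  have hK := orderOf_pos (π.trans (odometerPerm N))
  have hdich := fun p y hy => dyadicPoint_periodic hA hR hF p (y := y) hy
  set K := orderOf (π.trans (odometerPerm N))
  set bad : Fin (2 ^ N) → Prop := fun p =>
    ∃ j < K, (π (((π.trans (odometerPerm N)) ^ j) p) : ℕ) + 1 = 2 ^ N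
  have hsub : ∀ p : Fin (2 ^ N),
      Ico ((p : ℝ) / 2 ^ N) (((p : ℝ) + 1) / 2 ^ N) ⊆ Ico (0:ℝ) 1 := by
    intro p
    apply Ico_subset_Ico
    · positivity
    · rw [div_le_one (by positivity)]
      exact_mod_cast p.isLt
  have hgood : ∀ x ∈ Iper F, ∃ p : Fin (2 ^ N), ¬ bad p ∧
      x ∈ Ico ((p : ℝ) / 2 ^ N) (((p : ℝ) + 1) / 2 ^ N) ∧ IsPeriodicPt F K x := by
    rintro x ⟨hx, k, hk, hper⟩
    obtain ⟨p, hp⟩ := exists_mem_dyadic N hx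
    obtain ⟨y, hy, rfl⟩ := exists_dyadicPoint_eq_of_mem N p hp
    have hb : ¬ bad p := fun hb => (hdich p y hy).2 hb k hk hper
    exact ⟨p, hb, hp, (hdich p y hy).1 hb⟩
  refine ⟨⟨2 ^ N, fun p => if bad p then (0, 0) else
    ((p : ℝ) / 2 ^ N, ((p : ℝ) + 1) / 2 ^ N), ?_, ?_, ?_⟩, ?_⟩
  · ext x
    rw [mem_iUnion]
    constructor
    · intro hx
      obtain ⟨p, hb, hp, -⟩ := hgood x hx
      exact ⟨p, by dsimp only; rw [if_neg hb]; exact hp⟩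
    · rintro ⟨p, hp⟩
      dsimp only at hp
      split_ifs at hp with hb
      · simp at hp
      · obtain ⟨y, hy, rfl⟩ := exists_dyadicPoint_eq_of_mem N p hp
        exact ⟨hsub p hp, K, hK, (hdich p y hy).1 hb⟩
  · intro p
    dsimp only
    split_ifs
    · simp
    · exact hsub p
  · intro p p' hne
    dsimp only
    split_ifs
    · simp
    · simp
    · simp
    · rw [Set.disjoint_left]
      intro x hx hx'
      obtain ⟨y, hy, rfl⟩ := exists_dyadicPoint_eq_of_mem N p hx
      obtain ⟨y', hy', h⟩ := exists_dyadicPoint_eq_of_mem N p' hx'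
      exact hne (Fin.ext (dyadicPoint_fst_inj hy hy' h.symm))
  · apply (Set.finite_Iic K).subset
    rintro _ ⟨x, hx, rfl⟩
    obtain ⟨p, -, -, hper⟩ := hgood x hx
    exact hper.minimalPeriod_le hK
end
end

section
/- Let N ≥ 1, q = 2^N, let π be a permutation of {0,…,q−1}, and let λ_np be Lebesgue measure on I_np normalized so that λ_np(I_np) = 1. Then there exist an integer r with 1 ≤ r ≤ 2^N and an injective measurable map ψ : I_np → {0,…,r−1} × {0,1}^ℕ such that the pushforward of λ_np under ψ equals μ_S, the complement of the image of ψ is μ_S-null, and ψ ∘ F_π = a_S ∘ ψ on I_np. -/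
open MeasureTheory Set Function
open scoped ENNReal

noncomputable section

/-- The dyadic adding machine on `{0,1}^ℕ`: addition of 1 with carry to the right
(coordinate `n` is flipped iff all earlier coordinates equal `1`). -/
def addingMachine (w : ℕ → Bool) : ℕ → Bool :=
  fun n => if ∀ i < n, w i = true then !(w n) else w n

/-- The adding machine `a_S` on `{0,…,r-1} × {0,1}^ℕ`:
`a_S (s,x) = (s+1,x)` if `s < r-1`, and `a_S (r-1,x) = (0, a x)`. -/
def addS (r : ℕ) (p : Fin r × (ℕ → Bool)) : Fin r × (ℕ → Bool) :=
  if h : (p.1 : ℕ) + 1 < r then (⟨(p.1 : ℕ) + 1, h⟩, p.2)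
  else (⟨0, Nat.lt_of_le_of_lt (Nat.zero_le _) p.1.isLt⟩, addingMachine p.2)

/-- The Bernoulli measure `μ_S` on `{0,…,r-1} × {0,1}^ℕ`: the product of the uniform
measure on `Fin r` and the (1/2,1/2) Bernoulli measure, characterized on cylinders. -/
def IsBernoulliS (r : ℕ) (μ : Measure (Fin r × (ℕ → Bool))) : Prop :=
  ∀ (s : Fin r) (n : ℕ) (u : Fin n → Bool),
    μ {x | x.1 = s ∧ ∀ i : Fin n, x.2 (i : ℕ) = u i}
      = ((r : ℝ≥0∞))⁻¹ * ((2:ℝ≥0∞)⁻¹) ^ n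

/-- The point of `[0,1)` with leading binary digit `b` followed by the expansion of `z`. -/
def prependBit (b : Bool) (z : ℝ) : ℝ := ((if b then 1 else 0) + z) / 2

/-- The binary digits of the fractional part of `y`. -/
def binDigits (y : ℝ) (n : ℕ) : Bool := decide (1 / 2 ≤ Int.fract (2 ^ n * y))

theorem prependBit_mem (b : Bool) {z : ℝ} (hz : z ∈ Ico (0:ℝ) 1) :
    prependBit b z ∈ Ico (0:ℝ) 1 := by
  obtain ⟨h0, h1⟩ := hz
  cases b <;> simp only [prependBit] <;> constructor <;> norm_num <;> linarith

theorem exists_eq_prependBit {y : ℝ} (hy : y ∈ Ico (0:ℝ) 1) :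
    ∃ b, ∃ z ∈ Ico (0:ℝ) 1, y = prependBit b z := by
  obtain ⟨h0, h1⟩ := hy
  by_cases h : y < 1 / 2
  · exact ⟨false, 2 * y, ⟨by linarith, by linarith⟩, by simp [prependBit]⟩
  · exact ⟨true, 2 * y - 1, ⟨by linarith, by linarith⟩, by simp [prependBit]⟩

theorem binDigits_prependBit_zero (b : Bool) {z : ℝ} (hz : z ∈ Ico (0:ℝ) 1) :
    binDigits (prependBit b z) 0 = b := by
  have h := prependBit_mem b hz
  simp only [binDigits, pow_zero, one_mul]
  rw [Int.fract_eq_self.mpr h]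
  obtain ⟨h0, h1⟩ := hz
  cases b <;> simp [prependBit] <;> linarith

theorem binDigits_prependBit_succ (b : Bool) (z : ℝ) (n : ℕ) :
    binDigits (prependBit b z) (n + 1) = binDigits z n := by
  have h : (2:ℝ) ^ (n + 1) * prependBit b z = 2 ^ n * z + ((if b then 2 ^ n else 0 : ℕ) : ℝ) := by
    cases b <;> simp [prependBit] <;> ring
  simp only [binDigits]
  rw [h, Int.fract_add_natCast]

theorem abs_sub_le_of_binDigits_eq (n : ℕ) : ∀ {y z : ℝ}, y ∈ Ico (0:ℝ) 1 → z ∈ Ico (0:ℝ) 1 →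
    binDigits y = binDigits z → |y - z| ≤ (1 / 2) ^ n := by
  induction n with
  | zero =>
    rintro y z ⟨h0, h1⟩ ⟨h2, h3⟩ -
    rw [abs_le]
    constructor <;> norm_num <;> linarith
  | succ n ih =>
    intro y z hy hz h
    obtain ⟨b, y', hy', rfl⟩ := exists_eq_prependBit hy
    obtain ⟨c, z', hz', rfl⟩ := exists_eq_prependBit hz
    have hbc : b = c := by
      simpa [binDigits_prependBit_zero, hy', hz'] using congrFun h 0
    subst hbc
    have := ih hy' hz' (by
      funext k
      simpa [binDigits_prependBit_succ] using congrFun h (k + 1))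
    have e : prependBit b y' - prependBit b z' = (y' - z') * (1 / 2) := by
      simp only [prependBit]; ring
    rw [e, abs_mul, pow_succ, abs_of_pos (by norm_num : (0:ℝ) < 1 / 2)]
    gcongr

theorem binDigits_injOn : InjOn binDigits (Ico (0:ℝ) 1) := by
  intro y hy z hz h
  have h0 : |y - z| ≤ 0 :=
    ge_of_tendsto' (tendsto_pow_atTop_nhds_zero_of_lt_one (by norm_num) (by norm_num))
      fun n => abs_sub_le_of_binDigits_eq n hy hz h
  exact sub_eq_zero.mp (abs_nonpos_iff.mp h0)

theorem measurable_binDigits : Measurable binDigits := by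
  refine measurable_pi_lambda _ fun n => ?_
  have h : Measurable fun y : ℝ => Int.fract (2 ^ n * y) := by fun_prop
  refine measurable_to_bool ?_
  convert h (measurableSet_Ici (a := (1 / 2 : ℝ))) using 1
  ext y
  simp [binDigits]

theorem binDigits_cylinder_eq_Ico (n : ℕ) : ∀ u : ℕ → Bool, ∃ a : ℝ,
    {y ∈ Ico (0:ℝ) 1 | ∀ i < n, binDigits y i = u i} = Ico a (a + (1 / 2) ^ n) := by
  induction n with
  | zero => exact fun u => ⟨0, by simp [Ico]⟩
  | succ n ih =>
    intro u
    obtain ⟨a, ha⟩ := ih fun i => u (i + 1)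
    have ha' : ∀ z, (z ∈ Ico (0:ℝ) 1 ∧ ∀ i < n, binDigits z i = u (i + 1)) ↔
        z ∈ Ico a (a + (1 / 2) ^ n) := fun z => by rw [← ha]; rfl
    refine ⟨prependBit (u 0) a, ?_⟩
    ext y
    constructor
    · rintro ⟨hy, h⟩
      obtain ⟨b, z, hz, rfl⟩ := exists_eq_prependBit hy
      have hb := h 0 (Nat.succ_pos n)
      rw [binDigits_prependBit_zero b hz] at hb
      subst hb
      obtain ⟨h1, h2⟩ := (ha' z).1 ⟨hz, fun i hi => by
        rw [← h (i + 1) (by omega), binDigits_prependBit_succ]⟩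
      simp only [prependBit, pow_succ]
      constructor <;> linarith
    · rintro ⟨h1, h2⟩
      obtain ⟨z, rfl⟩ : ∃ z, y = prependBit (u 0) z :=
        ⟨2 * y - (if u 0 then 1 else 0), by simp [prependBit]⟩
      simp only [prependBit, pow_succ] at h1 h2
      obtain ⟨hz, h⟩ := (ha' z).2 ⟨by linarith, by linarith⟩
      refine ⟨prependBit_mem _ hz, fun i hi => ?_⟩
      cases i with
      | zero => exact binDigits_prependBit_zero _ hz
      | succ i => rw [binDigits_prependBit_succ, h i (by omega)]

/-- The real number in `[0,1]` with binary expansion `w`. -/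
def ofBits (w : ℕ → Bool) : ℝ := Cardinal.cantorFunction (1 / 2) w / 2

theorem ofBits_eq_prependBit (w : ℕ → Bool) :
    ofBits w = prependBit (w 0) (ofBits fun n => w (n + 1)) := by
  rw [ofBits, Cardinal.cantorFunction_succ w (by norm_num) (by norm_num)]
  cases w 0 <;> simp [prependBit, ofBits] <;> ring

theorem ofBits_nonneg (w : ℕ → Bool) : 0 ≤ ofBits w :=
  div_nonneg (tsum_nonneg fun _ => Cardinal.cantorFunctionAux_nonneg (by norm_num)) (by norm_num)

theorem ofBits_le_one (w : ℕ → Bool) : ofBits w ≤ 1 := by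
  have h : Cardinal.cantorFunction (1 / 2) w ≤ Cardinal.cantorFunction (1 / 2) fun _ => true :=
    Cardinal.cantorFunction_le (by norm_num) (by norm_num) fun _ _ => rfl
  have h2 : Cardinal.cantorFunction (1 / 2) (fun _ => true) = 2 := by
    simpa [Cardinal.cantorFunction, Cardinal.cantorFunctionAux] using tsum_geometric_two
  rw [ofBits]
  linarith

theorem ofBits_lt_one (n : ℕ) : ∀ w : ℕ → Bool, w n = false → ofBits w < 1 := by
  induction n with
  | zero =>
    intro w hw
    have := ofBits_le_one fun n => w (n + 1)
    rw [ofBits_eq_prependBit, hw]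
    simp only [prependBit]
    norm_num
    linarith
  | succ n ih =>
    intro w hw
    have := ih (fun n => w (n + 1)) hw
    rw [ofBits_eq_prependBit]
    cases w 0 <;> simp only [prependBit] <;> norm_num <;> linarith

theorem ofBits_mem_Ico {w : ℕ → Bool} (hw : ∀ n, ∃ m ≥ n, w m = false) :
    ofBits w ∈ Ico (0:ℝ) 1 := by
  obtain ⟨m, -, hm⟩ := hw 0
  exact ⟨ofBits_nonneg w, ofBits_lt_one m w hm⟩

theorem binDigits_ofBits {w : ℕ → Bool} (hw : ∀ n, ∃ m ≥ n, w m = false) :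
    binDigits (ofBits w) = w := by
  funext k
  induction k generalizing w with
  | zero =>
    rw [ofBits_eq_prependBit, binDigits_prependBit_zero]
    refine ofBits_mem_Ico fun n => ?_
    obtain ⟨m, hm, h⟩ := hw (n + 1)
    exact ⟨m - 1, by omega, by rwa [Nat.sub_add_cancel (by omega)]⟩
  | succ k ih =>
    rw [ofBits_eq_prependBit, binDigits_prependBit_succ]
    refine ih (w := fun n => w (n + 1)) fun n => ?_
    obtain ⟨m, hm, h⟩ := hw (n + 1)
    exact ⟨m - 1, by omega, by rwa [Nat.sub_add_cancel (by omega)]⟩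

theorem countable_compl_range_binDigits : (binDigits '' Ico (0:ℝ) 1)ᶜ.Countable := by
  have hsub : (binDigits '' Ico (0:ℝ) 1)ᶜ ⊆ ⋃ n : ℕ, {w : ℕ → Bool | ∀ m ≥ n, w m = true} := by
    intro w hw
    by_contra h
    refine hw ?_
    have h' : ∀ n, ∃ m ≥ n, w m = false := by simpa using h
    exact ⟨ofBits w, ofBits_mem_Ico h', binDigits_ofBits h'⟩
  refine Countable.mono hsub (countable_iUnion fun n => ?_)
  refine MapsTo.countable_of_injOn (f := fun w (i : Fin n) => w i) (t := univ)
    (fun _ _ => mem_univ _) ?_ (Set.to_countable _)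
  intro v hv w hw h
  funext m
  by_cases hm : m < n
  · exact congrFun h ⟨m, hm⟩
  · rw [hv m (by omega), hw m (by omega)]

theorem addingMachine_zero (w : ℕ → Bool) : addingMachine w 0 = !(w 0) := by
  simp [addingMachine]

theorem addingMachine_succ_of_true {w : ℕ → Bool} (h : w 0 = true) (n : ℕ) :
    addingMachine w (n + 1) = addingMachine (fun k => w (k + 1)) n := by
  have : (∀ i < n + 1, w i = true) ↔ ∀ i < n, w (i + 1) = true := by
    constructor
    · exact fun H i hi => H _ (by omega)
    · rintro H (_ | i) hi
      · exact h
      · exact H i (by omega)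
  simp only [addingMachine, this]

theorem addingMachine_succ_of_false {w : ℕ → Bool} (h : w 0 = false) (n : ℕ) :
    addingMachine w (n + 1) = w (n + 1) := by
  have : ¬ ∀ i < n + 1, w i = true := fun H => by simp [H 0 (by omega)] at h
  simp only [addingMachine, this, if_false]

namespace IsVNK

variable {A : ℝ → ℝ}

theorem prependBit_false (hA : IsVNK A) {z : ℝ} (hz : z ∈ Ico (0:ℝ) 1) :
    A (prependBit false z) = prependBit true z := by
  obtain ⟨h0, h1⟩ := hz
  rw [hA 1 le_rfl _ (by simp only [prependBit]; norm_num; constructor <;> linarith)]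
  simp only [prependBit]
  norm_num
  ring

theorem exists_mem_Ico {z : ℝ} (hz : z ∈ Ico (0:ℝ) 1) : ∃ n : ℕ, 1 ≤ n ∧
    z ∈ Ico (1 - (2:ℝ) ^ (1 - (n:ℤ))) (1 - (2:ℝ) ^ (-(n:ℤ))) := by
  obtain ⟨h0, h1⟩ := hz
  obtain ⟨n, hn1, hn2⟩ := exists_nat_pow_near_of_lt_one (x := 1 - z) (y := 1 / 2)
    (by linarith) (by linarith) (by norm_num) (by norm_num)
  refine ⟨n + 1, by omega, ?_⟩
  have e1 : (2:ℝ) ^ (1 - ((n + 1 : ℕ):ℤ)) = (1 / 2) ^ n := by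
    rw [show (1 - ((n + 1 : ℕ):ℤ)) = -(n:ℤ) by push_cast; ring, zpow_neg, zpow_natCast]
    simp
  have e2 : (2:ℝ) ^ (-((n + 1 : ℕ):ℤ)) = (1 / 2) ^ (n + 1) := by
    rw [zpow_neg, zpow_natCast]
    simp
  rw [e1, e2]
  constructor <;> linarith

theorem prependBit_true (hA : IsVNK A) {z : ℝ} (hz : z ∈ Ico (0:ℝ) 1) :
    A (prependBit true z) = prependBit false (A z) := by
  obtain ⟨n, hn, hzn⟩ := exists_mem_Ico hz
  have e1 : (2:ℝ) ^ (1 - ((n + 1 : ℕ):ℤ)) = 2 ^ (1 - (n:ℤ)) / 2 := by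
    rw [show (1 - (n:ℤ)) = (1 - ((n + 1 : ℕ):ℤ)) + 1 by push_cast; ring,
      zpow_add₀ (by norm_num), zpow_one]
    ring
  have e2 : (2:ℝ) ^ (-((n + 1 : ℕ):ℤ)) = 2 ^ (-(n:ℤ)) / 2 := by
    rw [show (-(n:ℤ)) = (-((n + 1 : ℕ):ℤ)) + 1 by push_cast; ring,
      zpow_add₀ (by norm_num), zpow_one]
    ring
  have hz2 := hzn
  obtain ⟨h0, h1⟩ := hz2
  rw [hA n hn z hzn, hA (n + 1) (by omega) _ (by
    rw [e1, e2]; simp only [prependBit, if_true]; constructor <;> linarith), e2]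
  simp only [prependBit]
  norm_num
  ring

theorem mapsTo (hA : IsVNK A) : MapsTo A (Ico (0:ℝ) 1) (Ico (0:ℝ) 1) := by
  intro z hz
  obtain ⟨n, hn, hzn⟩ := exists_mem_Ico hz
  have e1 : (2:ℝ) ^ (1 - (n:ℤ)) = 2 * 2 ^ (-(n:ℤ)) := by
    rw [show (1 - (n:ℤ)) = 1 + -(n:ℤ) by ring, zpow_add₀ (by norm_num), zpow_one]
  have hp : (0:ℝ) < 2 ^ (-(n:ℤ)) := by positivity
  have hle : (2:ℝ) ^ (-(n:ℤ)) ≤ 2 ^ (-(1:ℤ)) := zpow_le_zpow_right₀ (by norm_num) (by omega)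
  norm_num at hle
  rw [hA n hn z hzn]
  obtain ⟨h0, h1⟩ := hzn
  rw [e1] at h0
  norm_num at *
  constructor <;> linarith

theorem binDigits_apply (hA : IsVNK A) {y : ℝ} (hy : y ∈ Ico (0:ℝ) 1) :
    binDigits (A y) = addingMachine (binDigits y) := by
  funext n
  induction n generalizing y with
  | zero =>
    obtain ⟨b, z, hz, rfl⟩ := exists_eq_prependBit hy
    rw [addingMachine_zero, binDigits_prependBit_zero b hz]
    cases b
    · rw [hA.prependBit_false hz, binDigits_prependBit_zero _ hz]; rfl
    · rw [hA.prependBit_true hz, binDigits_prependBit_zero _ (hA.mapsTo hz)]; rfl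
  | succ n ih =>
    obtain ⟨b, z, hz, rfl⟩ := exists_eq_prependBit hy
    have h0 := binDigits_prependBit_zero b hz
    cases b
    · rw [hA.prependBit_false hz, addingMachine_succ_of_false h0, binDigits_prependBit_succ,
        binDigits_prependBit_succ]
    · rw [hA.prependBit_true hz, addingMachine_succ_of_true h0, binDigits_prependBit_succ, ih hz]
      simp only [binDigits_prependBit_succ]

theorem iterate_two_mul_prependBit (hA : IsVNK A) (j : ℕ) (b : Bool) {z : ℝ}
    (hz : z ∈ Ico (0:ℝ) 1) : A^[2 * j] (prependBit b z) = prependBit b (A^[j] z) := by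
  induction j generalizing z with
  | zero => rfl
  | succ j ih =>
    rw [show 2 * (j + 1) = 2 * j + 1 + 1 by ring, iterate_succ_apply, iterate_succ_apply,
      iterate_succ_apply, ← ih (hA.mapsTo hz)]
    congr 1
    cases b
    · rw [hA.prependBit_false hz, hA.prependBit_true hz]
    · rw [hA.prependBit_true hz, hA.prependBit_false (hA.mapsTo hz)]

theorem iterate_ne_self_s5 (hA : IsVNK A) (k : ℕ) : ∀ {y : ℝ}, y ∈ Ico (0:ℝ) 1 → 1 ≤ k →
    A^[k] y ≠ y := by
  induction k using Nat.strong_induction_on with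
  | _ k ih =>
    intro y hy hk h
    obtain ⟨b, z, hz, rfl⟩ := exists_eq_prependBit hy
    obtain ⟨j, rfl | rfl⟩ := Nat.even_or_odd' k
    · rw [hA.iterate_two_mul_prependBit j b hz] at h
      refine ih j (by omega) hz (by omega) ?_
      simpa [prependBit] using h
    · have hj := hA.mapsTo.iterate j hz
      rw [iterate_succ_apply', hA.iterate_two_mul_prependBit j b hz] at h
      have h0 := congrArg (fun y => binDigits y 0) h
      simp only [hA.binDigits_apply (prependBit_mem b hj), addingMachine_zero,
        binDigits_prependBit_zero b hj, binDigits_prependBit_zero b hz] at h0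
      cases b <;> simp at h0

end IsVNK

/-- Addition of `1` to the leading binary digit of an `N`-digit number `p < 2 ^ N`, with carry
towards the less significant digits and without final carry. -/
def carryStep : ℕ → ℕ → ℕ
  | 0, _ => 0
  | N + 1, p => if p < 2 ^ N then p + 2 ^ N else carryStep N (p - 2 ^ N)

theorem carryStep_lt (N : ℕ) : ∀ p < 2 ^ N, carryStep N p < 2 ^ N := by
  induction N with
  | zero => simp [carryStep]
  | succ N ih =>
    intro p hp
    rw [pow_succ] at hp ⊢
    simp only [carryStep]
    split_ifs
    · omega
    · have := ih (p - 2 ^ N) (by omega)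
      omega

theorem carryStep_inj (N : ℕ) : ∀ p < 2 ^ N, ∀ p' < 2 ^ N,
    carryStep N p = carryStep N p' → p = p' := by
  induction N with
  | zero => intro p hp p' hp' _; simp at hp hp'; omega
  | succ N ih =>
    intro p hp p' hp' h
    rw [pow_succ] at hp hp'
    have h1 := carryStep_lt N (p - 2 ^ N)
    have h2 := carryStep_lt N (p' - 2 ^ N)
    simp only [carryStep] at h
    split_ifs at h
    · omega
    · have := h2 (by omega); omega
    · have := h1 (by omega); omega
    · have := ih (p - 2 ^ N) (by omega) (p' - 2 ^ N) (by omega) h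
      omega

theorem IsVNK.apply_carryStep {A : ℝ → ℝ} (hA : IsVNK A) (N : ℕ) : ∀ p : ℕ, p < 2 ^ N →
    ∀ y ∈ Ico (0:ℝ) 1, A ((p + y) / 2 ^ N) =
      (carryStep N p + (if carryStep N p = 0 then A y else y)) / 2 ^ N := by
  induction N with
  | zero => intro p hp y _; simp at hp; simp [carryStep, hp]
  | succ N ih =>
    intro p hp y hy
    have hq : (0:ℝ) < 2 ^ N := by positivity
    have hmem : ∀ k : ℕ, k < 2 ^ N → ((k + y) / 2 ^ N : ℝ) ∈ Ico (0:ℝ) 1 := by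
      intro k hk
      have hk' : (k:ℝ) + 1 ≤ 2 ^ N := by exact_mod_cast hk
      obtain ⟨h0, h1⟩ := hy
      exact ⟨by positivity, by rw [div_lt_one hq]; linarith⟩
    simp only [carryStep]
    split_ifs with h h' h'
    · have : 0 < 2 ^ N := by positivity
      omega
    · have e : ((p + y) / 2 ^ (N + 1) : ℝ) = prependBit false ((p + y) / 2 ^ N) := by
        simp [prependBit, pow_succ]; field_simp
      rw [e, hA.prependBit_false (hmem p h)]
      simp only [prependBit, pow_succ]
      simp
      field_simp
      ring
    all_goals
      have hp' : p - 2 ^ N < 2 ^ N := by rw [pow_succ] at hp; omega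
      have e : ((p + y) / 2 ^ (N + 1) : ℝ) =
          prependBit true (((p - 2 ^ N : ℕ) + y) / 2 ^ N) := by
        rw [Nat.cast_sub (by omega)]
        simp [prependBit, pow_succ]; field_simp; ring
      rw [e, hA.prependBit_true (hmem _ hp'), ih _ hp' y hy]
      simp [prependBit, pow_succ, h']
      field_simp

/-- The point with relative position `y` in the `p`-th of `q` equal subintervals of `[0,1)`. -/
def liftPoint {q : ℕ} (p : Fin q) (y : ℝ) : ℝ := ((p : ℕ) + y) / q

theorem liftPoint_mem {q : ℕ} (p : Fin q) {y : ℝ} (hy : y ∈ Ico (0:ℝ) 1) :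
    liftPoint p y ∈ Ico (0:ℝ) 1 := by
  have hq : (0:ℝ) < q := by exact_mod_cast p.pos
  have hp : ((p : ℕ):ℝ) + 1 ≤ q := by exact_mod_cast p.isLt
  obtain ⟨h0, h1⟩ := hy
  exact ⟨by unfold liftPoint; positivity, by rw [liftPoint, div_lt_one hq]; linarith⟩

theorem mul_liftPoint {q : ℕ} (p : Fin q) (y : ℝ) : q * liftPoint p y = (p : ℕ) + y := by
  have hq : (q:ℝ) ≠ 0 := by exact_mod_cast p.pos.ne'
  rw [liftPoint]
  field_simp

theorem liftPoint_right_injective {q : ℕ} (p : Fin q) : Injective (liftPoint p) := by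
  intro y z h
  have := congrArg (fun x : ℝ => q * x) h
  simpa [mul_liftPoint] using this

theorem exists_eq_liftPoint {q : ℕ} (hq : 0 < q) {x : ℝ} (hx : x ∈ Ico (0:ℝ) 1) :
    ∃ p : Fin q, ∃ y ∈ Ico (0:ℝ) 1, x = liftPoint p y := by
  have hq' : (0:ℝ) < q := by exact_mod_cast hq
  obtain ⟨h0, h1⟩ := hx
  have hnn : 0 ≤ q * x := by positivity
  have hlt : ⌊q * x⌋₊ < q := by rw [Nat.floor_lt hnn]; nlinarith
  refine ⟨⟨⌊q * x⌋₊, hlt⟩, q * x - ⌊q * x⌋₊, ⟨?_, ?_⟩, ?_⟩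
  · linarith [Nat.floor_le hnn]
  · linarith [Nat.lt_floor_add_one (q * x)]
  · rw [liftPoint]
    field_simp
    ring

/-- `F` moves the `q` equal subintervals of `[0,1)` by translations according to `σ`, except that
`A`, rescaled, is applied when entering the leftmost subinterval. -/
def IsTowerMap {q : ℕ} (σ : Equiv.Perm (Fin q)) (A F : ℝ → ℝ) : Prop :=
  ∀ p : Fin q, ∀ y ∈ Ico (0:ℝ) 1,
    F (liftPoint p y) = liftPoint (σ p) (if (σ p : ℕ) = 0 then A y else y)

theorem measurableSet_cylinder {r n : ℕ} (s : Fin r) (u : Fin n → Bool) :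
    MeasurableSet {x : Fin r × (ℕ → Bool) | x.1 = s ∧ ∀ i : Fin n, x.2 (i : ℕ) = u i} := by
  have h : {x : Fin r × (ℕ → Bool) | x.1 = s ∧ ∀ i : Fin n, x.2 (i : ℕ) = u i} =
      Prod.fst ⁻¹' {s} ∩ ⋂ i : Fin n, (fun x : Fin r × (ℕ → Bool) => x.2 (i : ℕ)) ⁻¹' {u i} := by
    ext x
    simp
  rw [h]
  exact (measurable_fst (measurableSet_singleton s)).inter <| MeasurableSet.iInter fun i =>
    ((measurable_pi_apply (i : ℕ)).comp measurable_snd) (measurableSet_singleton (u i))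

section Tower

variable {q : ℕ} [NeZero q] {σ : Equiv.Perm (Fin q)} {A F : ℝ → ℝ}

theorem minimalPeriod_pos_of_perm (σ : Equiv.Perm (Fin q)) : 0 < minimalPeriod σ 0 :=
  minimalPeriod_pos_of_mem_periodicPts (σ.injective.mem_periodicPts 0)

theorem minimalPeriod_le_of_perm (σ : Equiv.Perm (Fin q)) : minimalPeriod σ 0 ≤ q := by
  have h : Injective fun s : Fin (minimalPeriod σ 0) => σ^[s] 0 := fun s t hst =>
    Fin.ext (iterate_injOn_Iio_minimalPeriod s.isLt t.isLt hst)
  simpa using Fintype.card_le_of_injective _ h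

theorem iterate_ne_zero_of_lt {j : ℕ} (h0 : 0 < j) (hj : j < minimalPeriod σ 0) :
    σ^[j] 0 ≠ 0 := fun h =>
  not_isPeriodicPt_of_pos_of_lt_minimalPeriod h0.ne' hj h

/-- The coding of `[0,1)` by the level in the tower over the leftmost subinterval and the binary
digits of the relative position. -/
def towerCode (σ : Equiv.Perm (Fin q)) (x : ℝ) : Fin (minimalPeriod σ 0) × (ℕ → Bool) :=
  open Classical in
  (if h : ∃ s : Fin (minimalPeriod σ 0), ((σ^[s] 0 : Fin q) : ℤ) = ⌊q * x⌋ then h.choose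
    else ⟨0, minimalPeriod_pos_of_perm σ⟩, binDigits (Int.fract (q * x)))

theorem towerCode_liftPoint (σ : Equiv.Perm (Fin q)) (s : Fin (minimalPeriod σ 0)) {y : ℝ}
    (hy : y ∈ Ico (0:ℝ) 1) : towerCode σ (liftPoint (σ^[s] 0) y) = (s, binDigits y) := by
  have hfr : Int.fract y = y := Int.fract_eq_self.mpr hy
  have hfl : ⌊y⌋ = 0 := Int.floor_eq_zero_iff.mpr hy
  have h : ∃ t : Fin (minimalPeriod σ 0),
      ((σ^[t] 0 : Fin q) : ℤ) = ⌊q * liftPoint (σ^[s] 0) y⌋ :=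
    ⟨s, by rw [mul_liftPoint, Int.floor_natCast_add, hfl, add_zero]⟩
  rw [towerCode, dif_pos h]
  refine Prod.ext ?_ (by simp only [mul_liftPoint, Int.fract_natCast_add, hfr])
  have hs := h.choose_spec.trans
    (by rw [mul_liftPoint, Int.floor_natCast_add, hfl, add_zero] :
      ⌊q * liftPoint (σ^[s] 0) y⌋ = ((σ^[s] 0 : Fin q) : ℤ))
  refine Fin.ext (iterate_injOn_Iio_minimalPeriod h.choose.isLt s.isLt ?_)
  exact Fin.ext (by exact_mod_cast hs)

theorem measurable_towerCode (σ : Equiv.Perm (Fin q)) : Measurable (towerCode σ) := by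
  have h : Measurable fun x : ℝ => (q:ℝ) * x := by fun_prop
  refine Measurable.prodMk ?_ (measurable_binDigits.comp h.fract)
  classical
  exact (measurable_from_top (f := fun m : ℤ =>
    if h : ∃ s : Fin (minimalPeriod σ 0), ((σ^[s] 0 : Fin q) : ℤ) = m then h.choose
      else ⟨0, minimalPeriod_pos_of_perm σ⟩)).comp h.floor

namespace IsTowerMap

theorem iterate_liftPoint (hF : IsTowerMap σ A F) (p : Fin q) {y : ℝ} (hy : y ∈ Ico (0:ℝ) 1)
    (k : ℕ) (hk : ∀ j, 1 ≤ j → j ≤ k → σ^[j] p ≠ 0) :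
    F^[k] (liftPoint p y) = liftPoint (σ^[k] p) y := by
  induction k with
  | zero => rfl
  | succ k ih =>
    rw [iterate_succ_apply', ih fun j h1 h2 => hk j h1 (by omega), hF _ y hy,
      ← iterate_succ_apply' σ, if_neg]
    exact fun h => hk (k + 1) (by omega) le_rfl (Fin.ext (by simpa using h))

theorem iterate_minimalPeriod (hF : IsTowerMap σ A F) (hA : IsVNK A)
    {s : ℕ} (hs : s < minimalPeriod σ 0) {y : ℝ} (hy : y ∈ Ico (0:ℝ) 1) :
    F^[minimalPeriod σ 0] (liftPoint (σ^[s] 0) y) = liftPoint (σ^[s] 0) (A y) := by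
  obtain ⟨m, hm⟩ : ∃ m, minimalPeriod σ 0 = s + (1 + m) :=
    ⟨minimalPeriod σ 0 - s - 1, by omega⟩
  have h1 : F^[m] (liftPoint (σ^[s] 0) y) = liftPoint (σ^[m] (σ^[s] 0)) y := by
    refine hF.iterate_liftPoint _ hy m fun j h1 h2 => ?_
    rw [← iterate_add_apply]
    exact iterate_ne_zero_of_lt (by omega) (by omega)
  have h2 : σ (σ^[m] (σ^[s] 0)) = 0 := by
    rw [← iterate_add_apply, ← iterate_succ_apply' σ, show (m + s).succ = minimalPeriod σ 0 by omega,
      Function.iterate_minimalPeriod]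
  have h3 : F^[s] (liftPoint 0 (A y)) = liftPoint (σ^[s] 0) (A y) :=
    hF.iterate_liftPoint _ (hA.mapsTo hy) s fun j h1 h2 =>
      iterate_ne_zero_of_lt (by omega) (by omega)
  nth_rewrite 1 [hm]
  rw [iterate_add_apply, iterate_add_apply, iterate_one, h1, hF _ y hy, h2, if_pos (by simp), h3]

theorem mem_Inp_iff (hF : IsTowerMap σ A F) (hA : IsVNK A) {x : ℝ} :
    x ∈ Inp F ↔ ∃ s : Fin (minimalPeriod σ 0), ∃ y ∈ Ico (0:ℝ) 1, x = liftPoint (σ^[s] 0) y := by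
  constructor
  · rintro ⟨hx, hper⟩
    obtain ⟨p, y, hy, rfl⟩ := exists_eq_liftPoint (Nat.pos_of_neZero q) hx
    by_contra! hno
    refine hper ⟨hx, minimalPeriod σ p,
      minimalPeriod_pos_of_mem_periodicPts (σ.injective.mem_periodicPts p), ?_⟩
    rw [hF.iterate_liftPoint p hy _ fun j _ _ hj => ?_, Function.iterate_minimalPeriod]
    obtain ⟨k, hk⟩ : ∃ k, σ^[k] 0 = p := by
      obtain ⟨n, hn, hpn⟩ := σ.injective.mem_periodicPts p
      refine ⟨j * n - j, ?_⟩
      have hle : j ≤ j * n := Nat.le_mul_of_pos_right _ hn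
      rw [← hj, ← iterate_add_apply, Nat.sub_add_cancel hle]
      exact (hpn.const_mul j)
    refine hno ⟨k % minimalPeriod σ 0, Nat.mod_lt _ (minimalPeriod_pos_of_perm σ)⟩ y hy ?_
    rw [iterate_mod_minimalPeriod_eq, hk]
  · rintro ⟨s, y, hy, rfl⟩
    refine ⟨liftPoint_mem _ hy, ?_⟩
    rintro ⟨-, k, hk, h⟩
    have h1 : ∀ j, F^[minimalPeriod σ 0 * j] (liftPoint (σ^[s] 0) y) =
        liftPoint (σ^[s] 0) (A^[j] y) := by
      intro j
      induction j with
      | zero => rfl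
      | succ j ih =>
        rw [Nat.mul_succ, Nat.add_comm, iterate_add_apply, ih,
          hF.iterate_minimalPeriod hA s.isLt (hA.mapsTo.iterate j hy), iterate_succ_apply']
    have h2 : IsPeriodicPt F (minimalPeriod σ 0 * k) (liftPoint (σ^[s] 0) y) :=
      IsPeriodicPt.const_mul h _
    exact hA.iterate_ne_self_s5 k hy hk (liftPoint_right_injective _ ((h1 k).symm.trans h2))

theorem towerCode_apply (hF : IsTowerMap σ A F) (hA : IsVNK A) {x : ℝ} (hx : x ∈ Inp F) :
    towerCode σ (F x) = addS (minimalPeriod σ 0) (towerCode σ x) := by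
  obtain ⟨s, y, hy, rfl⟩ := (hF.mem_Inp_iff hA).1 hx
  rw [towerCode_liftPoint σ s hy, hF _ y hy, ← iterate_succ_apply' σ, addS]
  split_ifs with h0 h1 h1
  · exact absurd (Fin.ext (by simpa using h0)) (iterate_ne_zero_of_lt (Nat.succ_pos s) h1)
  · have e : σ^[(s : ℕ).succ] 0 = σ^[((⟨0, minimalPeriod_pos_of_perm σ⟩ :
        Fin (minimalPeriod σ 0)) : ℕ)] 0 := Fin.ext (by simpa using h0)
    rw [e, towerCode_liftPoint σ _ (hA.mapsTo hy), hA.binDigits_apply hy]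
  · exact towerCode_liftPoint σ ⟨s + 1, h1⟩ hy
  · refine absurd ?_ h0
    have : (s : ℕ).succ = minimalPeriod σ 0 := by have := s.isLt; simp only at h1; omega
    rw [this, Function.iterate_minimalPeriod]
    simp

theorem injOn_towerCode (hF : IsTowerMap σ A F) (hA : IsVNK A) :
    InjOn (towerCode σ) (Inp F) := by
  intro x hx x' hx' h
  obtain ⟨s, y, hy, rfl⟩ := (hF.mem_Inp_iff hA).1 hx
  obtain ⟨t, z, hz, rfl⟩ := (hF.mem_Inp_iff hA).1 hx'
  rw [towerCode_liftPoint σ s hy, towerCode_liftPoint σ t hz, Prod.mk.injEq] at h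
  rw [h.1, binDigits_injOn hy hz h.2]

theorem countable_compl_image_towerCode (hF : IsTowerMap σ A F) (hA : IsVNK A) :
    (towerCode σ '' Inp F)ᶜ.Countable := by
  refine ((Set.to_countable (univ : Set (Fin (minimalPeriod σ 0)))).prod
    countable_compl_range_binDigits).mono ?_
  rintro ⟨s, w⟩ h
  refine ⟨mem_univ _, ?_⟩
  rintro ⟨y, hy, rfl⟩
  exact h ⟨_, (hF.mem_Inp_iff hA).2 ⟨s, y, hy, rfl⟩, towerCode_liftPoint σ s hy⟩

theorem volume_cylinder (hF : IsTowerMap σ A F) (hA : IsVNK A) (s : Fin (minimalPeriod σ 0))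
    (n : ℕ) (u : Fin n → Bool) :
    volume (towerCode σ ⁻¹' {x | x.1 = s ∧ ∀ i : Fin n, x.2 i = u i} ∩ Inp F) =
      (q : ℝ≥0∞)⁻¹ * (2⁻¹ : ℝ≥0∞) ^ n := by
  obtain ⟨a, ha⟩ := binDigits_cylinder_eq_Ico n fun i => if h : i < n then u ⟨i, h⟩ else false
  have hq : (0:ℝ) < q := by exact_mod_cast Nat.pos_of_neZero q
  have ha' : ∀ y, (y ∈ Ico (0:ℝ) 1 ∧ ∀ i : Fin n, binDigits y i = u i) ↔
      y ∈ Ico a (a + (1 / 2) ^ n) := by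
    intro y
    rw [← ha, mem_ofPred_eq]
    refine and_congr_right fun _ => ⟨fun H i hi => ?_, fun H i => ?_⟩
    · rw [dif_pos hi]; exact H ⟨i, hi⟩
    · rw [H i i.isLt, dif_pos i.isLt]
  have hset : towerCode σ ⁻¹' {x | x.1 = s ∧ ∀ i : Fin n, x.2 i = u i} ∩ Inp F =
      Ico (liftPoint (σ^[s] 0) a) (liftPoint (σ^[s] 0) (a + (1 / 2) ^ n)) := by
    ext x
    constructor
    · rintro ⟨h, hx⟩
      obtain ⟨t, y, hy, rfl⟩ := (hF.mem_Inp_iff hA).1 hx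
      rw [mem_preimage, towerCode_liftPoint σ t hy] at h
      obtain ⟨rfl, h⟩ := h
      obtain ⟨h1, h2⟩ := (ha' y).1 ⟨hy, h⟩
      exact ⟨by unfold liftPoint; gcongr, by unfold liftPoint; gcongr⟩
    · rintro ⟨h1, h2⟩
      obtain ⟨y, rfl⟩ : ∃ y, x = liftPoint (σ^[s] 0) y :=
        ⟨q * x - (σ^[s] 0 : Fin q), by rw [liftPoint]; field_simp; ring⟩
      rw [liftPoint, liftPoint, div_le_div_iff_of_pos_right hq] at h1
      rw [liftPoint, liftPoint, div_lt_div_iff_of_pos_right hq] at h2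
      obtain ⟨hy, h⟩ := (ha' y).2 ⟨by linarith, by linarith⟩
      refine ⟨?_, (hF.mem_Inp_iff hA).2 ⟨s, y, hy, rfl⟩⟩
      rw [mem_preimage, towerCode_liftPoint σ s hy]
      exact ⟨rfl, h⟩
  have hlen : liftPoint (σ^[s] 0) (a + (1 / 2) ^ n) - liftPoint (σ^[s] 0) a =
      (q : ℝ)⁻¹ * (2⁻¹) ^ n := by
    simp only [liftPoint]
    field_simp
    ring
  rw [hset, Real.volume_Ico, hlen, ENNReal.ofReal_mul (by positivity),
    ENNReal.ofReal_inv_of_pos hq, ENNReal.ofReal_natCast, ENNReal.ofReal_pow (by positivity),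
    ENNReal.ofReal_inv_of_pos (by norm_num), ENNReal.ofReal_ofNat]

theorem volume_Inp (hF : IsTowerMap σ A F) (hA : IsVNK A) :
    volume (Inp F) = minimalPeriod σ 0 * (q : ℝ≥0∞)⁻¹ := by
  have hmeas : ∀ s : Fin (minimalPeriod σ 0),
      MeasurableSet (towerCode σ ⁻¹' {x | x.1 = s ∧ ∀ i : Fin 0, x.2 i = i.elim0}) :=
    fun s => measurable_towerCode σ (measurableSet_cylinder s fun i : Fin 0 => i.elim0)
  have hunion : (⋃ s : Fin (minimalPeriod σ 0),
      towerCode σ ⁻¹' {x | x.1 = s ∧ ∀ i : Fin 0, x.2 i = i.elim0}) = univ := by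
    ext x; simp
  have hsum := measure_iUnion (μ := volume.restrict (Inp F))
    (f := fun s : Fin (minimalPeriod σ 0) =>
      towerCode σ ⁻¹' {x | x.1 = s ∧ ∀ i : Fin 0, x.2 i = i.elim0})
    (fun s t hst => disjoint_left.mpr fun x hxs hxt => hst (hxs.1.symm.trans hxt.1)) hmeas
  rw [hunion, Measure.restrict_apply_univ, tsum_fintype] at hsum
  rw [hsum, Finset.sum_congr rfl fun s _ => by
    rw [Measure.restrict_apply (hmeas s), hF.volume_cylinder hA s 0]]
  simp

theorem isBernoulliS_map (hF : IsTowerMap σ A F) (hA : IsVNK A) :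
    IsBernoulliS (minimalPeriod σ 0)
      (Measure.map (towerCode σ) ((volume (Inp F))⁻¹ • volume.restrict (Inp F))) := by
  intro s n u
  have hS : MeasurableSet {x : Fin (minimalPeriod σ 0) × (ℕ → Bool) |
      x.1 = s ∧ ∀ i : Fin n, x.2 (i : ℕ) = u i} := measurableSet_cylinder s u
  have hq : (q : ℝ≥0∞)⁻¹ ≠ 0 := by simp
  have hq' : (q : ℝ≥0∞)⁻¹ ≠ ∞ := by simp [NeZero.ne q]
  rw [Measure.map_apply (measurable_towerCode σ) hS, Measure.smul_apply,
    Measure.restrict_apply (measurable_towerCode σ hS), hF.volume_cylinder hA, hF.volume_Inp hA,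
    smul_eq_mul, ENNReal.mul_inv (Or.inr hq') (Or.inr hq), ← mul_assoc,
    mul_assoc (minimalPeriod σ 0 : ℝ≥0∞)⁻¹, ENNReal.inv_mul_cancel hq hq', mul_one]

theorem map_compl_image (hF : IsTowerMap σ A F) (hA : IsVNK A) :
    Measure.map (towerCode σ) ((volume (Inp F))⁻¹ • volume.restrict (Inp F))
      (towerCode σ '' Inp F)ᶜ = 0 := by
  have hm := (hF.countable_compl_image_towerCode hA).measurableSet
  rw [Measure.map_apply (measurable_towerCode σ) hm, Measure.smul_apply,
    Measure.restrict_apply (measurable_towerCode σ hm)]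
  have : towerCode σ ⁻¹' (towerCode σ '' Inp F)ᶜ ∩ Inp F = ∅ := by
    ext x
    simp only [mem_inter_iff, mem_preimage, mem_compl_iff, mem_empty_iff_false, iff_false, not_and]
    exact fun h hx => h (mem_image_of_mem _ hx)
  rw [this]
  simp

end IsTowerMap

end Tower

theorem exists_isTowerMap_rotated_odometer {N : ℕ} {π : Equiv.Perm (Fin (2 ^ N))} {A R F : ℝ → ℝ}
    (hA : IsVNK A) (hR : IsIET (2 ^ N) π R) (hF : ∀ x, F x = A (R x)) :
    ∃ σ : Equiv.Perm (Fin (2 ^ N)), IsTowerMap σ A F := by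
  let c : Fin (2 ^ N) → Fin (2 ^ N) := fun p => ⟨carryStep N p, carryStep_lt N p p.isLt⟩
  have hc : Injective c := fun p p' h =>
    Fin.ext (carryStep_inj N p p.isLt p' p'.isLt (congrArg Fin.val h))
  refine ⟨π.trans (Equiv.ofBijective c (Finite.injective_iff_bijective.1 hc)), fun p y hy => ?_⟩
  have hq : (0:ℝ) < ((2 ^ N : ℕ) : ℝ) := by positivity
  have hRp : R (liftPoint p y) = ((π p : ℕ) + y) / 2 ^ N := by
    rw [hR p _ ?_]
    · simp only [liftPoint]
      push_cast
      field_simp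
      ring
    · obtain ⟨h0, h1⟩ := hy
      unfold liftPoint
      exact ⟨by gcongr; linarith, by gcongr⟩
  rw [hF, hRp, hA.apply_carryStep N _ (π p).isLt y hy]
  simp [liftPoint, c]

/-- for `q = 2^N` the aperiodic part `(I_np, F_π, λ_np)` of the rotated
odometer, with normalized Lebesgue measure, is measurably isomorphic to the adding
machine `a_S` on `{0,…,r-1} × {0,1}^ℕ` with Bernoulli measure `μ_S`, for some
`1 ≤ r ≤ 2^N`. -/
theorem stmt5 (N : ℕ) (hN : 1 ≤ N) (π : Equiv.Perm (Fin (2^N)))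
    (A R F : ℝ → ℝ) (hA : IsVNK A) (hR : IsIET (2^N) π R) (hF : ∀ x, F x = A (R x)) :
    ∃ r : ℕ, 1 ≤ r ∧ r ≤ 2^N ∧
    ∃ (μS : Measure (Fin r × (ℕ → Bool))) (ψ : ℝ → Fin r × (ℕ → Bool)),
      IsBernoulliS r μS ∧
      Set.InjOn ψ (Inp F) ∧
      Measurable ψ ∧
      Measure.map ψ ((volume (Inp F))⁻¹ • volume.restrict (Inp F)) = μS ∧
      μS ((ψ '' Inp F)ᶜ) = 0 ∧
      ∀ x ∈ Inp F, ψ (F x) = addS r (ψ x) := by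
  obtain ⟨σ, hσ⟩ := exists_isTowerMap_rotated_odometer hA hR hF
  exact ⟨minimalPeriod σ 0, minimalPeriod_pos_of_perm σ, minimalPeriod_le_of_perm σ, _,
    towerCode σ, hσ.isBernoulliS_map hA, hσ.injOn_towerCode hA, measurable_towerCode σ, rfl,
    hσ.map_compl_image hA, fun _ hx => hσ.towerCode_apply hA hx⟩
end
end

section
/- Let g be a prefix-preserving homeomorphism of {0,1}^ℕ and suppose there exists m ≥ 1 such that g(w)_i = w_i for every w ∈ {0,1}^ℕ and every i > m. Then: (a) the homeomorphism a ∘ g has infinite order; (b) there exists a nonempty clopen set U ⊆ {0,1}^ℕ with (a ∘ g)(U) = U such that for every x ∈ U the full orbit {(a ∘ g)^k(x) : k ∈ ℤ} is dense in U; and (c) there exists n₀ ≥ 0 such that every x ∈ {0,1}^ℕ ∖ U is periodic under a ∘ g with minimal period 2^k for some k ≤ n₀. -/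
open MeasureTheory Set Function
open scoped ENNReal

noncomputable section

/-- `f` is prefix-preserving (induced by an automorphism of the rooted binary tree):
if `v, w` agree in their first `n` coordinates, then so do `f v, f w`. -/
def PrefixPreserving (f : (ℕ → Bool) → (ℕ → Bool)) : Prop :=
  ∀ (n : ℕ) (v w : ℕ → Bool), (∀ i < n, v i = w i) → ∀ i < n, f v i = f w i

/-- `v` and `w` agree in their first `n` coordinates. -/
abbrev PrefixEq (n : ℕ) (v w : ℕ → Bool) : Prop := ∀ i < n, v i = w i

namespace PrefixPreserving

variable {f g : (ℕ → Bool) → (ℕ → Bool)}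

theorem comp (hf : PrefixPreserving f) (hg : PrefixPreserving g) : PrefixPreserving (f ∘ g) :=
  fun n v w h => hf n _ _ (hg n v w h)

theorem iterate (hf : PrefixPreserving f) (k : ℕ) : PrefixPreserving f^[k] := by
  induction k with
  | zero => exact fun _ _ _ h => h
  | succ k ih => exact ih.comp hf

theorem prefixEq_of_surjective (hf : PrefixPreserving f) (hs : Surjective f) {n : ℕ}
    {v w : ℕ → Bool} (h : PrefixEq n (f v) (f w)) : PrefixEq n v w := by
  let ext : (Fin n → Bool) → ℕ → Bool := fun u i => if hi : i < n then u ⟨i, hi⟩ else false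
  let F : (Fin n → Bool) → (Fin n → Bool) := fun u i => f (ext u) i
  have hF (x : ℕ → Bool) : F (fun i => x i) = fun i : Fin n => f x i := by
    funext i
    exact hf n _ _ (fun j hj => by simp [ext, hj]) i i.2
  have hsurj : Surjective F := by
    intro u
    obtain ⟨x, hx⟩ := hs (ext u)
    refine ⟨fun i => x i, ?_⟩
    rw [hF, hx]
    funext i
    simp [ext]
  have hinj := Finite.injective_iff_surjective.2 hsurj
  have := @hinj (fun i => v i) (fun i => w i) (by
    rw [hF, hF]
    funext i
    exact h i i.2)
  exact fun i hi => congrFun this ⟨i, hi⟩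

theorem prefixEq_iterate_two_pow (hf : PrefixPreserving f) (hs : Surjective f) (n : ℕ)
    (w : ℕ → Bool) : PrefixEq n (f^[2 ^ n] w) w := by
  induction n generalizing w with
  | zero => exact fun i hi => absurd hi (Nat.not_lt_zero i)
  | succ n ih =>
    rw [pow_succ, mul_two, iterate_add_apply]
    have hext (v : ℕ → Bool) (h : f^[2 ^ n] v n = v n) : PrefixEq (n + 1) (f^[2 ^ n] v) v := by
      intro i hi
      rcases Nat.lt_succ_iff_lt_or_eq.1 hi with hi | rfl
      · exact ih v i hi
      · exact h
    intro i hi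
    by_cases h : f^[2 ^ n] w n = w n
    · have h1 := hext w h
      exact (hf.iterate _ _ _ _ h1 i hi).trans (h1 i hi)
    · rcases Nat.lt_succ_iff_lt_or_eq.1 hi with hi | rfl
      · exact (ih _ i hi).trans (ih w i hi)
      · by_contra h2
        have h3 : f^[2 ^ i] (f^[2 ^ i] w) i = f^[2 ^ i] w i := by
          revert h h2
          generalize f^[2 ^ i] (f^[2 ^ i] w) i = a
          generalize f^[2 ^ i] w i = b
          generalize w i = c
          revert a b c
          decide
        exact h ((hf.iterate _).prefixEq_of_surjective (hs.iterate _) (hext _ h3) i hi)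

theorem prefixEq_iterate_two_pow_mul (hf : PrefixPreserving f) (hs : Surjective f) (n c : ℕ)
    (w : ℕ → Bool) : PrefixEq n (f^[2 ^ n * c] w) w := by
  induction c with
  | zero => exact fun _ _ => rfl
  | succ c ih =>
    rw [mul_add_one, add_comm, iterate_add_apply]
    exact fun i hi => (hf.prefixEq_iterate_two_pow hs n _ i hi).trans (ih i hi)

end PrefixPreserving

theorem prefixPreserving_addingMachine : PrefixPreserving addingMachine := by
  intro n v w h i hi
  have : (∀ j < i, v j = true) ↔ ∀ j < i, w j = true :=
    forall₂_congr fun j hj => by rw [h j (hj.trans hi)]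
  simp only [addingMachine, this, h i hi]

theorem addingMachine_prefix_false_iff (n : ℕ) (v : ℕ → Bool) :
    (∀ i < n, addingMachine v i = false) ↔ ∀ i < n, v i = true := by
  constructor
  · intro h i
    induction i using Nat.strong_induction_on with
    | _ i ih =>
      intro hi
      have h1 := h i hi
      rw [addingMachine, if_pos fun j hj => ih j hj (hj.trans hi)] at h1
      simpa using h1
  · intro h i hi
    rw [addingMachine, if_pos fun j hj => h j (hj.trans hi), h i hi, Bool.not_true]

theorem surjective_addingMachine : Surjective addingMachine := by
  intro s
  refine ⟨fun n => if ∀ i < n, s i = false then !(s n) else s n, ?_⟩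
  funext n
  induction n using Nat.strong_induction_on with
  | _ n ih =>
    set t : ℕ → Bool := fun n => if ∀ i < n, s i = false then !(s n) else s n with ht
    have h1 : (∀ i < n, t i = true) ↔ ∀ i < n, s i = false :=
      (addingMachine_prefix_false_iff n t).symm.trans
        (forall₂_congr fun j hj => by rw [ih j hj])
    by_cases h : ∀ i < n, s i = false
    · rw [addingMachine, if_pos (h1.2 h), ht]
      simp only [if_pos h, Bool.not_not]
    · rw [addingMachine, if_neg (mt h1.1 h), ht]
      simp only [if_neg h]

/-- The sequence `w` with its first `n` coordinates deleted. -/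
def dropPrefix (n : ℕ) (w : ℕ → Bool) : ℕ → Bool := fun i => w (n + i)

theorem dropPrefix_addingMachine_of_forall {n : ℕ} {v : ℕ → Bool} (h : ∀ i < n, v i = true) :
    dropPrefix n (addingMachine v) = addingMachine (dropPrefix n v) := by
  funext j
  have : (∀ i < n + j, v i = true) ↔ ∀ i < j, v (n + i) = true := by
    refine ⟨fun H i hi => H _ (by omega), fun H i hi => ?_⟩
    by_cases hin : i < n
    · exact h i hin
    · have := H (i - n) (by omega)
      rwa [Nat.add_sub_cancel' (not_lt.1 hin)] at this
  by_cases h' : ∀ i < j, v (n + i) = true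
  · exact (if_pos (this.2 h')).trans (if_pos h').symm
  · exact (if_neg (mt this.1 h')).trans (if_neg h').symm

theorem dropPrefix_addingMachine_of_not_forall {n : ℕ} {v : ℕ → Bool}
    (h : ¬ ∀ i < n, v i = true) : dropPrefix n (addingMachine v) = dropPrefix n v := by
  funext j
  exact if_neg fun H => h fun i hi => H i (by omega)

theorem dropPrefix_addingMachine_iterate_two_pow (n : ℕ) (t : ℕ → Bool) :
    dropPrefix n (addingMachine^[2 ^ n] t) = addingMachine (dropPrefix n t) := by
  induction n generalizing t with
  | zero =>
    have h (s : ℕ → Bool) : dropPrefix 0 s = s := funext fun i => by simp [dropPrefix]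
    simp [h]
  | succ n ih =>
    have hd (s : ℕ → Bool) : dropPrefix (n + 1) s = dropPrefix 1 (dropPrefix n s) :=
      funext fun i => congrArg s (by omega)
    rw [pow_succ, mul_two, iterate_add_apply, hd, ih, ih, hd]
    generalize dropPrefix n t = s
    have h0 : addingMachine s 0 = !(s 0) := by simp [addingMachine]
    cases hs : s 0
    · rw [dropPrefix_addingMachine_of_forall (by simp [h0, hs]),
        dropPrefix_addingMachine_of_not_forall (by simp [hs])]
    · rw [dropPrefix_addingMachine_of_not_forall (by simp [h0, hs]),
        dropPrefix_addingMachine_of_forall (by simp [hs])]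

theorem addingMachine_iterate_two_pow_apply_self (n : ℕ) (t : ℕ → Bool) :
    addingMachine^[2 ^ n] t n = !(t n) := by
  have := congrFun (dropPrefix_addingMachine_iterate_two_pow n t) 0
  simpa [dropPrefix, addingMachine] using this

theorem addingMachine_iterate_ne (k : ℕ) (hk : k ≠ 0) (t : ℕ → Bool) :
    addingMachine^[k] t ≠ t := by
  obtain ⟨n, c, ⟨d, rfl⟩, rfl⟩ := Nat.exists_eq_two_pow_mul_odd hk
  intro h
  have h1 : PrefixEq (n + 1) (addingMachine^[2 ^ (n + 1) * d] t) t :=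
    prefixPreserving_addingMachine.prefixEq_iterate_two_pow_mul surjective_addingMachine _ _ _
  have h2 := congrFun h n
  rw [show 2 ^ n * (2 * d + 1) = 2 ^ n + 2 ^ (n + 1) * d by ring, iterate_add_apply,
    addingMachine_iterate_two_pow_apply_self, h1 n (Nat.lt_succ_self n)] at h2
  simp at h2

theorem exists_addingMachine_iterate_prefixEq (n : ℕ) (t s : ℕ → Bool) :
    ∃ j, PrefixEq n (addingMachine^[j] t) s := by
  induction n with
  | zero => exact ⟨0, fun i hi => absurd hi (Nat.not_lt_zero i)⟩
  | succ n ih =>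
    obtain ⟨j, hj⟩ := ih
    by_cases h : addingMachine^[j] t n = s n
    · refine ⟨j, fun i hi => ?_⟩
      rcases Nat.lt_succ_iff_lt_or_eq.1 hi with hi | rfl
      exacts [hj i hi, h]
    · refine ⟨2 ^ n + j, fun i hi => ?_⟩
      rw [iterate_add_apply]
      rcases Nat.lt_succ_iff_lt_or_eq.1 hi with hi | rfl
      · exact (prefixPreserving_addingMachine.prefixEq_iterate_two_pow
          surjective_addingMachine n _ i hi).trans (hj i hi)
      · rw [addingMachine_iterate_two_pow_apply_self]
        exact Bool.not_eq.2 h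

/-- The constant sequence `0`. -/
abbrev zeroSeq : ℕ → Bool := fun _ => false

/-- The points whose forward orbit under `f` meets the cylinder of `0^m`. -/
def reachingZero (f : (ℕ → Bool) → (ℕ → Bool)) (m : ℕ) : Set (ℕ → Bool) :=
  {x | ∃ k, PrefixEq m (f^[k] x) zeroSeq}

section ReachingZero

variable {f : (ℕ → Bool) → (ℕ → Bool)} {m : ℕ}

theorem isOpen_of_prefixEq {S : Set (ℕ → Bool)}
    (h : ∀ x ∈ S, ∀ y, PrefixEq m y x → y ∈ S) : IsOpen S := by
  rw [isOpen_iff_forall_mem_open]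
  exact fun x hx => ⟨PiNat.cylinder x m, fun y hy => h x hx y hy,
    PiNat.isOpen_cylinder _ x m, PiNat.self_mem_cylinder x m⟩

theorem PrefixPreserving.mem_reachingZero (hf : PrefixPreserving f) {x y : ℕ → Bool}
    (h : PrefixEq m x y) (hy : y ∈ reachingZero f m) : x ∈ reachingZero f m := by
  obtain ⟨k, hk⟩ := hy
  exact ⟨k, fun i hi => (hf.iterate k m x y h i hi).trans (hk i hi)⟩

theorem PrefixPreserving.isClopen_reachingZero (hf : PrefixPreserving f) :
    IsClopen (reachingZero f m) := by
  refine ⟨⟨?_⟩, ?_⟩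
  · exact isOpen_of_prefixEq (m := m) fun x hx y h hy =>
      hx (hf.mem_reachingZero (fun i hi => (h i hi).symm) hy)
  · exact isOpen_of_prefixEq (m := m) fun x hx y h => hf.mem_reachingZero h hx

theorem PrefixPreserving.image_reachingZero (hf : PrefixPreserving f) (hs : Surjective f) :
    f '' reachingZero f m = reachingZero f m := by
  apply Subset.antisymm
  · rintro _ ⟨x, ⟨k, hk⟩, rfl⟩
    refine ⟨k + (2 ^ m - 1), fun i hi => ?_⟩
    rw [← iterate_succ_apply, Nat.succ_eq_add_one, add_assoc,
      Nat.sub_add_cancel Nat.one_le_two_pow, add_comm, iterate_add_apply]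
    exact (hf.prefixEq_iterate_two_pow hs m _ i hi).trans (hk i hi)
  · intro y hy
    obtain ⟨x, rfl⟩ := hs y
    obtain ⟨k, hk⟩ := hy
    exact ⟨x, ⟨k + 1, hk⟩, rfl⟩

theorem eq_of_prefixEq_of_dropPrefix_eq {x y : ℕ → Bool} (h : PrefixEq m x y)
    (h' : dropPrefix m x = dropPrefix m y) : x = y := by
  funext i
  by_cases hi : i < m
  · exact h i hi
  · have := congrFun h' (i - m)
    simpa only [dropPrefix, Nat.add_sub_cancel' (not_lt.1 hi)] using this

theorem dropPrefix_iterate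
    (hne : ∀ w, ¬ PrefixEq m (f w) zeroSeq → dropPrefix m (f w) = dropPrefix m w)
    {x : ℕ → Bool} {k : ℕ} (h : ∀ j, 1 ≤ j → j ≤ k → ¬ PrefixEq m (f^[j] x) zeroSeq) :
    dropPrefix m (f^[k] x) = dropPrefix m x := by
  induction k with
  | zero => rfl
  | succ k ih =>
    have := h (k + 1) (by omega) le_rfl
    rw [iterate_succ_apply'] at this ⊢
    rw [hne _ this]
    exact ih fun j hj hjk => h j hj (by omega)

theorem PrefixPreserving.minimalPeriod_of_notMem_reachingZero (hf : PrefixPreserving f)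
    (hs : Surjective f)
    (hne : ∀ w, ¬ PrefixEq m (f w) zeroSeq → dropPrefix m (f w) = dropPrefix m w)
    {x : ℕ → Bool} (hx : x ∉ reachingZero f m) : ∃ k ≤ m, minimalPeriod f x = 2 ^ k := by
  have : IsPeriodicPt f (2 ^ m) x :=
    eq_of_prefixEq_of_dropPrefix_eq (hf.prefixEq_iterate_two_pow hs m x)
      (dropPrefix_iterate hne fun j _ _ h => hx ⟨j, h⟩)
  exact (Nat.dvd_prime_pow Nat.prime_two).1 this.minimalPeriod_dvd

theorem PrefixPreserving.exists_return_time (hf : PrefixPreserving f) (hs : Surjective f)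
    (hne : ∀ w, ¬ PrefixEq m (f w) zeroSeq → dropPrefix m (f w) = dropPrefix m w)
    (heq : ∀ w, PrefixEq m (f w) zeroSeq →
      dropPrefix m (f w) = addingMachine (dropPrefix m w)) :
    ∃ L, ∀ j z, PrefixEq m z zeroSeq → PrefixEq m (f^[L * j] z) zeroSeq ∧
      dropPrefix m (f^[L * j] z) = addingMachine^[j] (dropPrefix m z) := by
  classical
  have hex : ∃ L, PrefixEq m (f^[L + 1] zeroSeq) zeroSeq := by
    refine ⟨2 ^ m - 1, ?_⟩
    rw [Nat.sub_add_cancel Nat.one_le_two_pow]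
    exact hf.prefixEq_iterate_two_pow hs m _
  have hiter (k : ℕ) {z : ℕ → Bool} (hz : PrefixEq m z zeroSeq) :
      PrefixEq m (f^[k] z) zeroSeq ↔ PrefixEq m (f^[k] zeroSeq) zeroSeq :=
    forall₂_congr fun i hi => by rw [hf.iterate k m _ _ hz i hi]
  have hret (z : ℕ → Bool) (hz : PrefixEq m z zeroSeq) :
      PrefixEq m (f^[Nat.find hex + 1] z) zeroSeq ∧
        dropPrefix m (f^[Nat.find hex + 1] z) = addingMachine (dropPrefix m z) := by
    have h1 := (hiter _ hz).2 (Nat.find_spec hex)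
    refine ⟨h1, ?_⟩
    rw [iterate_succ_apply'] at h1 ⊢
    rw [heq _ h1, dropPrefix_iterate hne]
    intro j hj hjk h
    have := Nat.find_min hex (m := j - 1) (by omega)
    rw [Nat.sub_add_cancel hj] at this
    exact this ((hiter j hz).1 h)
  refine ⟨Nat.find hex + 1, fun j => ?_⟩
  induction j with
  | zero => exact fun z hz => ⟨hz, rfl⟩
  | succ j ih =>
    intro z hz
    obtain ⟨h1, h2⟩ := ih z hz
    obtain ⟨h3, h4⟩ := hret _ h1
    rw [mul_add_one, add_comm, iterate_add_apply, iterate_succ_apply' addingMachine, ← h2]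
    exact ⟨h3, h4⟩

theorem PrefixPreserving.exists_iterate_prefixEq (hf : PrefixPreserving f) (hs : Surjective f)
    (hne : ∀ w, ¬ PrefixEq m (f w) zeroSeq → dropPrefix m (f w) = dropPrefix m w)
    (heq : ∀ w, PrefixEq m (f w) zeroSeq →
      dropPrefix m (f w) = addingMachine (dropPrefix m w))
    {x y : ℕ → Bool} (hx : x ∈ reachingZero f m) (hy : y ∈ reachingZero f m) (n : ℕ) :
    ∃ k, PrefixEq n (f^[k] x) y := by
  obtain ⟨L, hL⟩ := hf.exists_return_time hs hne heq
  obtain ⟨k, hk⟩ := hx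
  obtain ⟨l, hl⟩ := hy
  obtain ⟨j, hj⟩ := exists_addingMachine_iterate_prefixEq n (dropPrefix m (f^[k] x))
    (dropPrefix m (f^[l] y))
  obtain ⟨h1, h2⟩ := hL j _ hk
  have h3 : PrefixEq n (f^[L * j] (f^[k] x)) (f^[l] y) := by
    intro i hi
    by_cases him : i < m
    · exact (h1 i him).trans (hl i him).symm
    · have := hj (i - m) (by omega)
      rw [← h2] at this
      simpa only [dropPrefix, Nat.add_sub_cancel' (not_lt.1 him)] using this
  rw [← iterate_add_apply] at h3
  have hle : l ≤ 2 ^ n * l + (L * j + k) := by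
    have := Nat.le_mul_of_pos_left l (Nat.two_pow_pos n)
    omega
  refine ⟨2 ^ n * l + (L * j + k) - l, (hf.iterate l).prefixEq_of_surjective (hs.iterate l) ?_⟩
  rw [← iterate_add_apply, Nat.add_sub_cancel' hle, iterate_add_apply]
  exact fun i hi => (hf.prefixEq_iterate_two_pow_mul hs n l _ i hi).trans (h3 i hi)

theorem PrefixPreserving.iterate_ne_id (hf : PrefixPreserving f) (hs : Surjective f)
    (hne : ∀ w, ¬ PrefixEq m (f w) zeroSeq → dropPrefix m (f w) = dropPrefix m w)
    (heq : ∀ w, PrefixEq m (f w) zeroSeq →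
      dropPrefix m (f w) = addingMachine (dropPrefix m w))
    {k : ℕ} (hk : k ≠ 0) : f^[k] ≠ id := by
  intro h
  obtain ⟨L, hL⟩ := hf.exists_return_time hs hne heq
  have h1 := (hL k zeroSeq fun _ _ => rfl).2
  rw [mul_comm, iterate_mul, h, iterate_id] at h1
  exact addingMachine_iterate_ne k hk _ h1.symm

end ReachingZero

/-- if `g` is a prefix-preserving homeomorphism of `{0,1}^ℕ` which changes
only the first `m` coordinates, then `a ∘ g` has infinite order, there is a nonempty
invariant clopen set `U` on which every full (two-sided) orbit is dense, and every point
outside `U` is periodic of minimal period `2^k` for some `k ≤ n₀`. -/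
theorem stmt7 (g : (ℕ → Bool) ≃ₜ (ℕ → Bool)) (hg : PrefixPreserving ⇑g)
    (m : ℕ) (hm : 1 ≤ m) (hfin : ∀ (w : ℕ → Bool) (i : ℕ), m ≤ i → g w i = w i) :
    (∀ k : ℕ, 1 ≤ k → (addingMachine ∘ ⇑g)^[k] ≠ id) ∧
    ∃ U : Set (ℕ → Bool), U.Nonempty ∧ IsClopen U ∧
      (addingMachine ∘ ⇑g) '' U = U ∧
      (∀ x ∈ U, U ⊆ closure
        {y | ∃ k : ℕ, (addingMachine ∘ ⇑g)^[k] x = y ∨ (addingMachine ∘ ⇑g)^[k] y = x}) ∧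
      ∃ n₀ : ℕ, ∀ x ∉ U, ∃ k ≤ n₀,
        Function.minimalPeriod (addingMachine ∘ ⇑g) x = 2^k := by
  have hf : PrefixPreserving (addingMachine ∘ ⇑g) := prefixPreserving_addingMachine.comp hg
  have hs : Surjective (addingMachine ∘ ⇑g) := surjective_addingMachine.comp g.surjective
  have hdrop (w : ℕ → Bool) : dropPrefix m (g w) = dropPrefix m w :=
    funext fun i => hfin w _ (Nat.le_add_right m i)
  have hne (w : ℕ → Bool) (h : ¬ PrefixEq m ((addingMachine ∘ ⇑g) w) zeroSeq) :
      dropPrefix m ((addingMachine ∘ ⇑g) w) = dropPrefix m w :=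
    (dropPrefix_addingMachine_of_not_forall
      (mt (addingMachine_prefix_false_iff m (g w)).2 h)).trans (hdrop w)
  have heq (w : ℕ → Bool) (h : PrefixEq m ((addingMachine ∘ ⇑g) w) zeroSeq) :
      dropPrefix m ((addingMachine ∘ ⇑g) w) = addingMachine (dropPrefix m w) :=
    (dropPrefix_addingMachine_of_forall ((addingMachine_prefix_false_iff m (g w)).1 h)).trans
      (congrArg addingMachine (hdrop w))
  refine ⟨fun k hk => hf.iterate_ne_id hs hne heq (Nat.one_le_iff_ne_zero.1 hk),
    reachingZero (addingMachine ∘ ⇑g) m, ⟨zeroSeq, 0, fun _ _ => rfl⟩,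
    hf.isClopen_reachingZero, hf.image_reachingZero hs, ?_, m,
    fun x hx => hf.minimalPeriod_of_notMem_reachingZero hs hne hx⟩
  intro x hx y hy
  rw [(PiNat.isTopologicalBasis_cylinders fun _ : ℕ => Bool).mem_closure_iff]
  rintro _ ⟨z, n, rfl⟩ hyz
  obtain ⟨k, hk⟩ := hf.exists_iterate_prefixEq hs hne heq hx hy n
  exact ⟨_, fun i hi => (hk i hi).trans (hyz i hi), k, Or.inl rfl⟩
end
end

section
/- For every n ≥ 1 and every 0 ≤ p < 2^n there is a unique τ_n(p) ∈ {0,…,2^n−1} such that ā([p 2^{−n}, (p+1) 2^{−n})) ⊆ [τ_n(p) 2^{−n}, (τ_n(p)+1) 2^{−n}); moreover the map τ_n is a permutation of {0,…,2^n−1} which is a single cycle of length 2^n (i.e., ⟨τ_n⟩ acts transitively on {0,…,2^n−1}). -/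
open MeasureTheory Set Function
open scoped ENNReal

noncomputable section

theorem IsVNK.apply_of_mem_s10 {A : ℝ → ℝ} (hA : IsVNK A) {m : ℕ} {x : ℝ}
    (h₁ : 1 - (1 / 2 : ℝ) ^ m ≤ x) (h₂ : x < 1 - (1 / 2 : ℝ) ^ (m + 1)) :
    A x = x - (1 - 3 * (1 / 2 : ℝ) ^ (m + 1)) := by
  have e₁ : (2 : ℝ) ^ (1 - ((m + 1 : ℕ) : ℤ)) = (1 / 2 : ℝ) ^ m := by
    rw [show (1 - ((m + 1 : ℕ) : ℤ)) = -(m : ℤ) by push_cast; ring, zpow_neg, zpow_natCast,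
      one_div, inv_pow]
  have e₂ : (2 : ℝ) ^ (-((m + 1 : ℕ) : ℤ)) = (1 / 2 : ℝ) ^ (m + 1) := by
    rw [zpow_neg, zpow_natCast, one_div, inv_pow]
  have h := hA (m + 1) (Nat.le_add_left 1 m) x
  rw [e₁, e₂] at h
  exact h ⟨h₁, h₂⟩

theorem exists_dyadic_piece {x : ℝ} (hx : x ∈ Set.Ico (0 : ℝ) 1) :
    ∃ m : ℕ, 1 - (1 / 2 : ℝ) ^ m ≤ x ∧ x < 1 - (1 / 2 : ℝ) ^ (m + 1) := by
  obtain ⟨m, h₁, h₂⟩ := exists_nat_pow_near_of_lt_one (x := 1 - x) (y := (1 / 2 : ℝ))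
    (by linarith [hx.2]) (by linarith [hx.1]) (by norm_num) (by norm_num)
  exact ⟨m, by linarith, by linarith⟩

theorem IsVNK.mapsTo_Ico {A : ℝ → ℝ} (hA : IsVNK A) :
    Set.MapsTo A (Set.Ico 0 1) (Set.Ico 0 1) := by
  intro x hx
  obtain ⟨m, h₁, h₂⟩ := exists_dyadic_piece hx
  rw [hA.apply_of_mem_s10 h₁ h₂]
  have hpos : (0 : ℝ) < (1 / 2) ^ m := by positivity
  have hle : (1 / 2 : ℝ) ^ m ≤ 1 := pow_le_one₀ (by norm_num) (by norm_num)
  rw [pow_succ] at h₂ ⊢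
  constructor <;> linarith

theorem IsVNK.apply_of_lt_half {A : ℝ → ℝ} (hA : IsVNK A) {x : ℝ} (h₀ : 0 ≤ x)
    (h₁ : x < 1 / 2) : A x = x + 1 / 2 := by
  rw [hA.apply_of_mem_s10 (m := 0) (by simpa using h₀) (by norm_num at h₁ ⊢; exact h₁)]
  ring

theorem IsVNK.apply_of_half_le {A : ℝ → ℝ} (hA : IsVNK A) {x : ℝ} (h₀ : 1 / 2 ≤ x)
    (h₁ : x < 1) : A x = A (2 * x - 1) / 2 := by
  obtain ⟨m, h₂, h₃⟩ := exists_dyadic_piece (x := 2 * x - 1) ⟨by linarith, by linarith⟩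
  have e : (1 / 2 : ℝ) ^ (m + 1 + 1) = (1 / 2 : ℝ) ^ (m + 1) / 2 := by ring
  have e' : (1 / 2 : ℝ) ^ (m + 1) = (1 / 2 : ℝ) ^ m / 2 := by ring
  rw [hA.apply_of_mem_s10 h₂ h₃, hA.apply_of_mem_s10 (m := m + 1) (by linarith) (by linarith)]
  linarith

/-- The action of the von Neumann–Kakutani map on the indices of the dyadic intervals of
length `2⁻ⁿ`. -/
def dyadicOdometer : ℕ → ℕ → ℕ
  | 0, _ => 0
  | n + 1, p => if p < 2 ^ n then p + 2 ^ n else dyadicOdometer n (p - 2 ^ n)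

theorem dyadicOdometer_succ_of_lt {n p : ℕ} (hp : p < 2 ^ n) :
    dyadicOdometer (n + 1) p = p + 2 ^ n := by
  rw [dyadicOdometer, if_pos hp]

theorem dyadicOdometer_succ_add (n p : ℕ) :
    dyadicOdometer (n + 1) (p + 2 ^ n) = dyadicOdometer n p := by
  rw [dyadicOdometer, if_neg (by omega), Nat.add_sub_cancel]

theorem dyadicOdometer_lt (n : ℕ) : ∀ p < 2 ^ n, dyadicOdometer n p < 2 ^ n := by
  induction n with
  | zero => intro p _; simp [dyadicOdometer]
  | succ n ih =>
    intro p hp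
    rw [pow_succ] at hp ⊢
    rcases lt_or_ge p (2 ^ n) with h | h
    · rw [dyadicOdometer_succ_of_lt h]
      omega
    · obtain ⟨r, rfl⟩ := Nat.exists_eq_add_of_le' h
      rw [dyadicOdometer_succ_add]
      have := ih r (by omega)
      omega

theorem IsVNK.mapsTo_dyadic {A : ℝ → ℝ} (hA : IsVNK A) (n : ℕ) : ∀ p : ℕ, p < 2 ^ n →
    Set.MapsTo A (Set.Ico ((p : ℝ) / 2 ^ n) (((p : ℝ) + 1) / 2 ^ n))
      (Set.Ico ((dyadicOdometer n p : ℝ) / 2 ^ n)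
        (((dyadicOdometer n p : ℝ) + 1) / 2 ^ n)) := by
  induction n with
  | zero =>
    intro p hp
    obtain rfl : p = 0 := by simpa using hp
    simpa [dyadicOdometer] using hA.mapsTo_Ico
  | succ n ih =>
    intro p hp x hx
    have hpos : (0 : ℝ) < 2 ^ n := by positivity
    have hpos' : (0 : ℝ) < 2 ^ (n + 1) := by positivity
    obtain ⟨h₁, h₂⟩ := hx
    rw [div_le_iff₀ hpos', pow_succ] at h₁
    rw [lt_div_iff₀ hpos', pow_succ] at h₂
    rw [Set.mem_Ico, div_le_iff₀ hpos', lt_div_iff₀ hpos', pow_succ]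
    rcases lt_or_ge p (2 ^ n) with h | h
    · have hc : (p : ℝ) + 1 ≤ 2 ^ n := by exact_mod_cast h
      have h₀ : 0 ≤ x := by
        by_contra! hneg
        nlinarith [(Nat.cast_nonneg p : (0 : ℝ) ≤ p)]
      have hx : x < 1 / 2 := by
        by_contra! hge
        nlinarith
      rw [hA.apply_of_lt_half h₀ hx, dyadicOdometer_succ_of_lt h]
      push_cast
      constructor <;> linarith
    · obtain ⟨r, rfl⟩ := Nat.exists_eq_add_of_le' h
      have hr : r < 2 ^ n := by rw [pow_succ] at hp; omega
      have hc : (r : ℝ) + 1 ≤ 2 ^ n := by exact_mod_cast hr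
      push_cast at h₁ h₂
      have h₀ : 1 / 2 ≤ x := by
        by_contra! hlt
        nlinarith [(Nat.cast_nonneg r : (0 : ℝ) ≤ r)]
      have hx : x < 1 := by
        by_contra! hge
        nlinarith
      have key := ih r hr (x := 2 * x - 1)
        ⟨by rw [div_le_iff₀ hpos]; linarith, by rw [lt_div_iff₀ hpos]; linarith⟩
      rw [Set.mem_Ico, div_le_iff₀ hpos, lt_div_iff₀ hpos] at key
      rw [hA.apply_of_half_le h₀ hx, dyadicOdometer_succ_add]
      constructor <;> linarith [key.1, key.2]

theorem dyadicOdometer_succ_iterate_two_mul (n k : ℕ) : ∀ p < 2 ^ n,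
    (dyadicOdometer (n + 1))^[2 * k] p = (dyadicOdometer n)^[k] p := by
  induction k with
  | zero => intro p _; rfl
  | succ k ih =>
    intro p hp
    rw [Nat.mul_succ, Function.iterate_add_apply, Function.iterate_succ_apply,
      Function.iterate_succ_apply, Function.iterate_zero_apply, Function.iterate_succ_apply,
      dyadicOdometer_succ_of_lt hp, dyadicOdometer_succ_add]
    exact ih _ (dyadicOdometer_lt n p hp)

theorem dyadicOdometer_transitive (n : ℕ) : ∀ p < 2 ^ n, ∀ q < 2 ^ n,
    ∃ k : ℕ, (dyadicOdometer n)^[k] p = q := by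
  induction n with
  | zero =>
    intro p hp q hq
    exact ⟨0, by simp at hp hq; simp [hp, hq]⟩
  | succ n ih =>
    have low : ∀ p < 2 ^ n, ∀ q < 2 ^ (n + 1),
        ∃ k : ℕ, (dyadicOdometer (n + 1))^[k] p = q := by
      intro p hp q hq
      rcases lt_or_ge q (2 ^ n) with h | h
      · obtain ⟨k, hk⟩ := ih p hp q h
        exact ⟨2 * k, by rw [dyadicOdometer_succ_iterate_two_mul n k p hp, hk]⟩
      · obtain ⟨r, rfl⟩ := Nat.exists_eq_add_of_le' h
        have hr : r < 2 ^ n := by rw [pow_succ] at hq; omega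
        obtain ⟨k, hk⟩ := ih p hp r hr
        exact ⟨2 * k + 1, by
          rw [Function.iterate_succ_apply', dyadicOdometer_succ_iterate_two_mul n k p hp, hk,
            dyadicOdometer_succ_of_lt hr]⟩
    intro p hp q hq
    rcases lt_or_ge p (2 ^ n) with h | h
    · exact low p h q hq
    · obtain ⟨r, rfl⟩ := Nat.exists_eq_add_of_le' h
      have hr : r < 2 ^ n := by rw [pow_succ] at hp; omega
      obtain ⟨k, hk⟩ := low _ (dyadicOdometer_lt n r hr) q hq
      exact ⟨k + 1, by rw [Function.iterate_succ_apply, dyadicOdometer_succ_add, hk]⟩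

theorem eq_of_mem_Ico_div {N y : ℝ} (hN : 0 < N) {i j : ℕ}
    (hi : y ∈ Set.Ico ((i : ℝ) / N) (((i : ℝ) + 1) / N))
    (hj : y ∈ Set.Ico ((j : ℝ) / N) (((j : ℝ) + 1) / N)) : i = j := by
  rw [Set.mem_Ico, div_le_iff₀ hN, lt_div_iff₀ hN] at hi hj
  have h₁ : i < j + 1 := by exact_mod_cast hi.1.trans_lt hj.2
  have h₂ : j < i + 1 := by exact_mod_cast hj.1.trans_lt hi.2
  omega

/-- for every `n ≥ 1` the von Neumann–Kakutani map `ā` maps each dyadic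
interval `[p/2^n, (p+1)/2^n)` into a unique dyadic interval `[τ_n(p)/2^n, (τ_n(p)+1)/2^n)`,
and the resulting map `τ_n` is a permutation of `{0,…,2^n-1}` which is a single cycle of
length `2^n`, i.e. `⟨τ_n⟩` acts transitively. -/
theorem stmt10 (A : ℝ → ℝ) (hA : IsVNK A) (n : ℕ) (hn : 1 ≤ n) :
    ∃ τ : Equiv.Perm (Fin (2^n)),
      (∀ p : Fin (2^n),
        Set.MapsTo A
          (Set.Ico (((p : ℕ) : ℝ) / 2^n) ((((p : ℕ) : ℝ) + 1) / 2^n))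
          (Set.Ico (((τ p : ℕ) : ℝ) / 2^n) ((((τ p : ℕ) : ℝ) + 1) / 2^n))) ∧
      (∀ p j : Fin (2^n),
        Set.MapsTo A
          (Set.Ico (((p : ℕ) : ℝ) / 2^n) ((((p : ℕ) : ℝ) + 1) / 2^n))
          (Set.Ico (((j : ℕ) : ℝ) / 2^n) ((((j : ℕ) : ℝ) + 1) / 2^n)) → j = τ p) ∧
      (∀ p q : Fin (2^n), ∃ k : ℕ, (⇑τ)^[k] p = q) := by
  let f : Fin (2 ^ n) → Fin (2 ^ n) :=
    fun p => ⟨dyadicOdometer n p, dyadicOdometer_lt n p p.isLt⟩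
  have hiter : ∀ (k : ℕ) (p : Fin (2 ^ n)), ((f^[k] p : Fin (2 ^ n)) : ℕ) =
      (dyadicOdometer n)^[k] p :=
    fun k => Function.Semiconj.iterate_right (f := Fin.val) (fun _ => rfl) k
  have htrans : ∀ p q : Fin (2 ^ n), ∃ k : ℕ, f^[k] p = q := by
    intro p q
    obtain ⟨k, hk⟩ := dyadicOdometer_transitive n p p.isLt q q.isLt
    exact ⟨k, Fin.ext ((hiter k p).trans hk)⟩
  have hsurj : Function.Surjective f := by
    intro q
    obtain ⟨k, hk⟩ := htrans (f q) q
    exact ⟨f^[k] q, by rw [← Function.iterate_succ_apply' f, Function.iterate_succ_apply, hk]⟩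
  have hmaps := fun p : Fin (2 ^ n) => hA.mapsTo_dyadic n p p.isLt
  refine ⟨Equiv.ofBijective f (Finite.surjective_iff_bijective.mp hsurj), hmaps, ?_, htrans⟩
  intro p j hj
  have hN : (0 : ℝ) < 2 ^ n := by positivity
  have hmem : ((p : ℕ) : ℝ) / 2 ^ n ∈
      Set.Ico (((p : ℕ) : ℝ) / 2 ^ n) ((((p : ℕ) : ℝ) + 1) / 2 ^ n) :=
    ⟨le_rfl, by gcongr; linarith⟩
  exact Fin.ext (eq_of_mem_Ico_div hN (hj hmem) (hmaps p hmem))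
end
end

section
/- Let N ≥ 1, q = 2^N, let π be a permutation of {0,…,q−1}, and set σ = τ_N ∘ π. For x ∈ [0,1) let p = ⌊qx⌋. If the ⟨σ⟩-orbit of p in {0,…,q−1} contains 0, then x is not periodic under the rotated odometer F_π; if the ⟨σ⟩-orbit of p does not contain 0, then x is periodic under F_π with minimal period equal to the cardinality of the ⟨σ⟩-orbit of p. -/
open MeasureTheory Set Function
open scoped ENNReal

noncomputable section

lemma IsVNK.apply_half {A : ℝ → ℝ} (hA : IsVNK A) {y : ℝ} (hy : y ∈ Ico (0:ℝ) 1) :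
    A (y / 2) = (1 + y) / 2 := by
  have h := hA 1 le_rfl (y / 2) (by
    norm_num
    constructor <;> linarith [hy.1, hy.2])
  rw [h]
  norm_num
  ring

lemma exists_mem_Ico_one_sub_two_zpow {y : ℝ} (hy : y ∈ Ico (0:ℝ) 1) :
    ∃ n : ℕ, 1 ≤ n ∧ y ∈ Ico (1 - (2:ℝ) ^ (1 - (n:ℤ))) (1 - (2:ℝ) ^ (-(n:ℤ))) := by
  obtain ⟨k, hk₁, hk₂⟩ :=
    exists_mem_Ioc_zpow (x := 1 - y) (y := (2:ℝ)) (by linarith [hy.2]) (by norm_num)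
  have hk : k < 0 := by
    by_contra! h
    have := one_le_zpow₀ (a := (2:ℝ)) (by norm_num) h
    linarith [hy.1]
  obtain ⟨n, rfl⟩ : ∃ n : ℕ, k = -(n:ℤ) := ⟨k.natAbs, by omega⟩
  refine ⟨n, by omega, ?_, by linarith⟩
  rw [show 1 - (n:ℤ) = -n + 1 by ring]
  linarith

lemma IsVNK.apply_half_add {A : ℝ → ℝ} (hA : IsVNK A) {y : ℝ} (hy : y ∈ Ico (0:ℝ) 1) :
    A ((1 + y) / 2) = A y / 2 := by
  obtain ⟨n, hn, hyn⟩ := exists_mem_Ico_one_sub_two_zpow hy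
  have e₁ : (2:ℝ) ^ (1 - ((n + 1 : ℕ) : ℤ)) = (2:ℝ) ^ (1 - (n:ℤ)) / 2 := by
    rw [show 1 - ((n + 1 : ℕ) : ℤ) = 1 - (n:ℤ) - 1 by push_cast; ring,
      zpow_sub_one₀ two_ne_zero, div_eq_mul_inv]
  have e₂ : (2:ℝ) ^ (-((n + 1 : ℕ) : ℤ)) = (2:ℝ) ^ (-(n:ℤ)) / 2 := by
    rw [show -((n + 1 : ℕ) : ℤ) = -(n:ℤ) - 1 by push_cast; ring,
      zpow_sub_one₀ two_ne_zero, div_eq_mul_inv]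
  have h := hA (n + 1) (by omega) ((1 + y) / 2) (by
    rw [e₁, e₂]
    constructor <;> linarith [hyn.1, hyn.2])
  rw [h, hA n hn y hyn, e₂]
  ring

lemma IsVNK.mapsTo_s11 {A : ℝ → ℝ} (hA : IsVNK A) : MapsTo A (Ico (0:ℝ) 1) (Ico (0:ℝ) 1) := by
  intro y hy
  obtain ⟨n, hn, hyn⟩ := exists_mem_Ico_one_sub_two_zpow hy
  have e : (2:ℝ) ^ (1 - (n:ℤ)) = 2 * (2:ℝ) ^ (-(n:ℤ)) := by
    rw [sub_eq_add_neg, zpow_add₀ two_ne_zero, zpow_one]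
  have h : (2:ℝ) ^ (-(n:ℤ)) ≤ 1 / 2 := by
    have := zpow_le_zpow_right₀ (a := (2:ℝ)) (by norm_num) (show -(n:ℤ) ≤ -1 by omega)
    norm_num at this ⊢
    exact this
  have hpos : (0:ℝ) < (2:ℝ) ^ (-(n:ℤ)) := by positivity
  rw [e] at hyn
  rw [hA n hn y (by rwa [e])]
  constructor <;> linarith [hyn.1, hyn.2]

lemma IsVNK.iterate_two_mul_half {A : ℝ → ℝ} (hA : IsVNK A) {y : ℝ} (hy : y ∈ Ico (0:ℝ) 1)
    (k : ℕ) : A^[2 * k] (y / 2) = A^[k] y / 2 := by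
  induction k with
  | zero => rfl
  | succ k ih =>
    have hk := hA.mapsTo_s11.iterate k hy
    rw [show 2 * (k + 1) = 2 * k + 1 + 1 by ring, iterate_succ_apply', iterate_succ_apply', ih,
      hA.apply_half hk, hA.apply_half_add hk, iterate_succ_apply']

lemma IsVNK.iterate_ne {A : ℝ → ℝ} (hA : IsVNK A) {m : ℕ} (hm : m ≠ 0) {x : ℝ}
    (hx : x ∈ Ico (0:ℝ) 1) : A^[m] x ≠ x := by
  induction m using Nat.strong_induction_on generalizing x with
  | _ m ih =>
    -- It is enough to treat the left half, since `A` maps it onto the right half.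
    have left : ∀ y ∈ Ico (0:ℝ) 1, A^[m] (y / 2) ≠ y / 2 := by
      intro y hy h
      obtain ⟨k, rfl | rfl⟩ := Nat.even_or_odd' m
      · rw [hA.iterate_two_mul_half hy] at h
        exact ih k (by omega) (by omega) hy (by linarith)
      · have hk := hA.mapsTo_s11.iterate k hy
        rw [iterate_succ_apply', hA.iterate_two_mul_half hy, hA.apply_half hk] at h
        linarith [hk.1, hy.2]
    intro h
    rcases lt_or_ge x (1 / 2) with hlt | hge
    · refine left (2 * x) ⟨by linarith [hx.1], by linarith⟩ ?_
      rwa [mul_div_cancel_left₀ x two_ne_zero]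
    · have hy : 2 * x - 1 ∈ Ico (0:ℝ) 1 := ⟨by linarith, by linarith [hx.2]⟩
      have hAx : A x = A (2 * x - 1) / 2 := by
        rw [← hA.apply_half_add hy]
        congr 1
        ring
      refine left _ (hA.mapsTo_s11 hy) ?_
      rw [← hAx, ← iterate_succ_apply, iterate_succ_apply', h]

lemma half_add_div_two_pow (N : ℕ) (a : ℝ) :
    (1 + a / 2 ^ N) / 2 = (2 ^ N + a) / 2 ^ (N + 1) := by
  field_simp
  ring

lemma add_div_two_pow_mem_Ico {N p : ℕ} (hp : p < 2 ^ N) {y : ℝ} (hy : y ∈ Ico (0:ℝ) 1) :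
    (p + y) / 2 ^ N ∈ Ico (0:ℝ) 1 := by
  have h : (p:ℝ) + 1 ≤ 2 ^ N := by exact_mod_cast hp
  refine ⟨div_nonneg (by linarith [hy.1, p.cast_nonneg (α := ℝ)]) (by positivity), ?_⟩
  rw [div_lt_one (by positivity)]
  linarith [hy.2]

lemma IsVNK.apply_last_s11 {A : ℝ → ℝ} (hA : IsVNK A) (N : ℕ) {y : ℝ} (hy : y ∈ Ico (0:ℝ) 1) :
    A ((2 ^ N - 1 + y) / 2 ^ N) = A y / 2 ^ N := by
  induction N with
  | zero => simp
  | succ N ih =>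
    have h := add_div_two_pow_mem_Ico (Nat.sub_lt (Nat.two_pow_pos N) one_pos) hy
    rw [Nat.cast_sub Nat.one_le_two_pow] at h
    push_cast at h
    have h' := hA.apply_half_add h
    rw [half_add_div_two_pow, ih, div_div, ← pow_succ] at h'
    rw [← h']
    congr 2
    ring

lemma IsVNK.exists_translation {A : ℝ → ℝ} (hA : IsVNK A) (N p : ℕ) (hp : p + 1 < 2 ^ N) :
    ∃ t : ℕ, ∀ y ∈ Ico (0:ℝ) 1, A ((p + y) / 2 ^ N) = (t + y) / 2 ^ N := by
  induction N generalizing p with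
  | zero => simp at hp
  | succ N ih =>
    rcases lt_or_ge p (2 ^ N) with h | h
    · refine ⟨2 ^ N + p, fun y hy => ?_⟩
      have h' := hA.apply_half (add_div_two_pow_mem_Ico h hy)
      rw [half_add_div_two_pow, div_div, ← pow_succ] at h'
      rw [h']
      push_cast
      ring
    · obtain ⟨p, rfl⟩ := Nat.exists_eq_add_of_le h
      rw [pow_succ] at hp
      obtain ⟨t, ht⟩ := ih p (by omega)
      refine ⟨t, fun y hy => ?_⟩
      have h' := hA.apply_half_add (add_div_two_pow_mem_Ico (N := N) (p := p) (by omega) hy)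
      rw [half_add_div_two_pow, ht y hy, div_div, ← pow_succ] at h'
      rw [← h']
      push_cast
      ring_nf

lemma add_div_mem_Ico_div {q : ℝ} (hq : 0 < q) (p : ℝ) {y : ℝ} (hy : y ∈ Ico (0:ℝ) 1) :
    (p + y) / q ∈ Ico (p / q) ((p + 1) / q) :=
  ⟨by gcongr; linarith [hy.1], by gcongr; exact hy.2⟩

/-- The dyadic interval containing a point and the relative position in it are unique. -/
lemma eq_of_add_eq_add {a b : ℕ} {y z : ℝ} (hy : y ∈ Ico (0:ℝ) 1) (hz : z ∈ Ico (0:ℝ) 1)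
    (h : (a:ℝ) + y = b + z) : a = b ∧ y = z := by
  have h₁ : (a:ℝ) < b + 1 := by linarith [hy.1, hz.2]
  have h₂ : (b:ℝ) < a + 1 := by linarith [hz.1, hy.2]
  have hab : a = b := by
    have : a < b + 1 := by exact_mod_cast h₁
    have : b < a + 1 := by exact_mod_cast h₂
    omega
  subst hab
  exact ⟨rfl, by linarith⟩

lemma eq_of_mem_Ico_div_s11 {q : ℝ} (hq : 0 < q) {a b : ℕ} {y : ℝ} (hy : y ∈ Ico (0:ℝ) 1)
    (h : (a + y) / q ∈ Ico ((b:ℝ) / q) ((b + 1) / q)) : a = b := by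
  have h₁ := (div_le_div_iff_of_pos_right hq).1 h.1
  have h₂ := (div_lt_div_iff_of_pos_right hq).1 h.2
  exact (eq_of_add_eq_add (z := a + y - b) hy ⟨by linarith, by linarith⟩ (by ring)).1

section RotatedOdometer

variable {N : ℕ} {π τ : Equiv.Perm (Fin (2 ^ N))} {A R F : ℝ → ℝ}

lemma IsVNK.apply_eq_ite (hA : IsVNK A)
    (hτ : ∀ p : Fin (2 ^ N),
      MapsTo A (Ico (((p : ℕ) : ℝ) / 2 ^ N) ((((p : ℕ) : ℝ) + 1) / 2 ^ N))
        (Ico (((τ p : ℕ) : ℝ) / 2 ^ N) ((((τ p : ℕ) : ℝ) + 1) / 2 ^ N)))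
    (p : Fin (2 ^ N)) {y : ℝ} (hy : y ∈ Ico (0:ℝ) 1) :
    A (((p : ℕ) + y) / 2 ^ N) = ((τ p : ℕ) + if τ p = 0 then A y else y) / 2 ^ N := by
  have hq : (0:ℝ) < 2 ^ N := by positivity
  have hτ' : ∀ (p : Fin (2 ^ N)) {z : ℝ}, z ∈ Ico (0:ℝ) 1 → _ :=
    fun p z hz => hτ p (add_div_mem_Ico_div hq _ hz)
  have hlast : ∀ p : Fin (2 ^ N), (p : ℕ) + 1 = 2 ^ N → ∀ z ∈ Ico (0:ℝ) 1,
      A (((p : ℕ) + z) / 2 ^ N) = A z / 2 ^ N := by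
    intro p hp z hz
    have hp' : ((p : ℕ) : ℝ) + 1 = 2 ^ N := by exact_mod_cast hp
    rw [← hA.apply_last_s11 N hz, ← hp']
    congr 2
    ring
  have hτlast : ∀ p : Fin (2 ^ N), (p : ℕ) + 1 = 2 ^ N → τ p = 0 := by
    intro p hp
    have h := hτ' p hy
    rw [hlast p hp y hy] at h
    have := eq_of_mem_Ico_div_s11 (a := 0) hq (hA.mapsTo_s11 hy) (by simpa using h)
    exact Fin.ext (by simpa using this.symm)
  rcases Nat.lt_or_ge ((p : ℕ) + 1) (2 ^ N) with hp | hp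
  · have hne : τ p ≠ 0 := by
      let l : Fin (2 ^ N) := ⟨2 ^ N - 1, by omega⟩
      rw [← hτlast l (by simp only [l]; omega)]
      intro h
      have := congrArg Fin.val (τ.injective h)
      simp only [l] at this
      omega
    obtain ⟨t, ht⟩ := hA.exists_translation N p hp
    have h := hτ' p hy
    rw [ht y hy] at h
    rw [if_neg hne, ht y hy, eq_of_mem_Ico_div_s11 hq hy h]
  · have hp' : (p : ℕ) + 1 = 2 ^ N := by omega
    rw [hlast p hp' y hy, hτlast p hp', if_pos rfl]
    simp

lemma rotatedOdometer_apply (hA : IsVNK A) (hR : IsIET (2 ^ N) π R) (hF : ∀ x, F x = A (R x))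
    (hτ : ∀ p : Fin (2 ^ N),
      MapsTo A (Ico (((p : ℕ) : ℝ) / 2 ^ N) ((((p : ℕ) : ℝ) + 1) / 2 ^ N))
        (Ico (((τ p : ℕ) : ℝ) / 2 ^ N) ((((τ p : ℕ) : ℝ) + 1) / 2 ^ N)))
    (p : Fin (2 ^ N)) {y : ℝ} (hy : y ∈ Ico (0:ℝ) 1) :
    F (((p : ℕ) + y) / 2 ^ N) =
      ((π.trans τ p : ℕ) + if π.trans τ p = 0 then A y else y) / 2 ^ N := by
  have h := hR p (((p : ℕ) + y) / 2 ^ N) (by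
    push_cast
    exact add_div_mem_Ico_div (by positivity) _ hy)
  rw [hF, h, Equiv.trans_apply, ← hA.apply_eq_ite hτ (π p) hy]
  congr 1
  push_cast
  ring

lemma rotatedOdometer_iterate (hA : IsVNK A) (hR : IsIET (2 ^ N) π R)
    (hF : ∀ x, F x = A (R x))
    (hτ : ∀ p : Fin (2 ^ N),
      MapsTo A (Ico (((p : ℕ) : ℝ) / 2 ^ N) ((((p : ℕ) : ℝ) + 1) / 2 ^ N))
        (Ico (((τ p : ℕ) : ℝ) / 2 ^ N) ((((τ p : ℕ) : ℝ) + 1) / 2 ^ N)))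
    (p : Fin (2 ^ N)) {y : ℝ} (hy : y ∈ Ico (0:ℝ) 1) (k : ℕ) :
    ∃ m : ℕ, F^[k] (((p : ℕ) + y) / 2 ^ N) =
        (((π.trans τ)^[k] p : ℕ) + A^[m] y) / 2 ^ N ∧
      (m = 0 ↔ ∀ j < k, (π.trans τ)^[j + 1] p ≠ 0) := by
  induction k with
  | zero => exact ⟨0, by simp⟩
  | succ k ih =>
    obtain ⟨m, hm, hm0⟩ := ih
    have h := rotatedOdometer_apply hA hR hF hτ ((π.trans τ)^[k] p) (hA.mapsTo_s11.iterate m hy)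
    rw [← hm, ← iterate_succ_apply' F, ← iterate_succ_apply' (π.trans τ)] at h
    by_cases h0 : (π.trans τ)^[k + 1] p = 0
    · rw [if_pos h0, ← iterate_succ_apply' A] at h
      exact ⟨m + 1, h, by simpa using ⟨k, by omega, h0⟩⟩
    · rw [if_neg h0] at h
      refine ⟨m, h, hm0.trans ⟨fun H j hj => ?_, fun H j hj => H j (by omega)⟩⟩
      rcases Nat.lt_succ_iff_lt_or_eq.1 hj with hj | rfl
      exacts [H j hj, h0]

end RotatedOdometer

lemma ncard_forward_orbit_eq_minimalPeriod {α : Type*} {f : α → α} {a : α}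
    (ha : a ∈ periodicPts f) : {b | ∃ k : ℕ, f^[k] a = b}.ncard = minimalPeriod f a := by
  have h : {b | ∃ k : ℕ, f^[k] a = b} = (fun k => f^[k] a) '' Iio (minimalPeriod f a) := by
    ext b
    constructor
    · rintro ⟨k, rfl⟩
      exact ⟨k % minimalPeriod f a, Nat.mod_lt _ (minimalPeriod_pos_of_mem_periodicPts ha),
        iterate_mod_minimalPeriod_eq⟩
    · rintro ⟨k, -, rfl⟩
      exact ⟨k, rfl⟩
  rw [h, iterate_injOn_Iio_minimalPeriod.ncard_image, ncard_eq_toFinset_card']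
  simp

/-- let `q = 2^N`, `σ = τ_N ∘ π`, and `x ∈ [p/q, (p+1)/q) ⊆ [0,1)`.
If the `⟨σ⟩`-orbit of `p` contains `0` then `x` is not periodic under `F_π = ā ∘ R_π`;
otherwise `x` is periodic with minimal period equal to the cardinality of the
`⟨σ⟩`-orbit of `p`. -/
theorem stmt11 (N : ℕ) (hN : 1 ≤ N) (π : Equiv.Perm (Fin (2^N)))
    (A R F : ℝ → ℝ) (hA : IsVNK A) (hR : IsIET (2^N) π R) (hF : ∀ x, F x = A (R x))
    (τ : Equiv.Perm (Fin (2^N)))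
    (hτ : ∀ p : Fin (2^N),
      Set.MapsTo A
        (Set.Ico (((p : ℕ) : ℝ) / 2^N) ((((p : ℕ) : ℝ) + 1) / 2^N))
        (Set.Ico (((τ p : ℕ) : ℝ) / 2^N) ((((τ p : ℕ) : ℝ) + 1) / 2^N)))
    (x : ℝ) (hx : x ∈ Set.Ico (0:ℝ) 1) (p : Fin (2^N))
    (hp : x ∈ Set.Ico (((p : ℕ) : ℝ) / 2^N) ((((p : ℕ) : ℝ) + 1) / 2^N)) :
    ((∃ k : ℕ, (⇑(π.trans τ))^[k] p = 0) → ¬ ∃ k, 1 ≤ k ∧ F^[k] x = x) ∧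
    ((¬ ∃ k : ℕ, (⇑(π.trans τ))^[k] p = 0) →
      (∃ k, 1 ≤ k ∧ F^[k] x = x) ∧
      Function.minimalPeriod F x
        = Set.ncard {j : Fin (2^N) | ∃ k : ℕ, (⇑(π.trans τ))^[k] p = j}) := by
  have hq : (0:ℝ) < 2 ^ N := by positivity
  obtain ⟨y, hy, rfl⟩ : ∃ y ∈ Ico (0:ℝ) 1, x = ((p : ℕ) + y) / 2 ^ N := by
    have h₁ := (div_le_iff₀ hq).1 hp.1
    have h₂ := (lt_div_iff₀ hq).1 hp.2
    exact ⟨x * 2 ^ N - (p : ℕ), ⟨by linarith, by linarith⟩, by field_simp; ring⟩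
  have key := rotatedOdometer_iterate hA hR hF hτ p hy
  have hper : p ∈ periodicPts (π.trans τ) :=
    (π.trans τ).injective.mem_periodicPts p
  constructor
  · rintro ⟨j, hj⟩ ⟨k, hk, hFk⟩
    obtain ⟨m, hm, hm0⟩ := key k
    rw [hFk, div_left_inj' hq.ne'] at hm
    obtain ⟨hpk, hyk⟩ := eq_of_add_eq_add hy (hA.mapsTo_s11.iterate m hy) hm
    have hm' : m = 0 := by
      by_contra h
      exact hA.iterate_ne h hy hyk.symm
    have hσ : IsPeriodicPt (π.trans τ) k p := (Fin.ext hpk).symm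
    rw [← hσ.iterate_mod_apply j] at hj
    have hlt := Nat.mod_lt j hk
    rcases Nat.eq_zero_or_pos (j % k) with h | h
    · rw [h] at hj
      refine hm0.1 hm' (k - 1) (by omega) ?_
      rw [Nat.sub_add_cancel hk, hσ.eq]
      exact hj
    · refine hm0.1 hm' (j % k - 1) (by omega) ?_
      rwa [Nat.sub_add_cancel h]
  · intro hno
    have hiff : ∀ k, IsPeriodicPt F k (((p : ℕ) + y) / 2 ^ N) ↔
        IsPeriodicPt (π.trans τ) k p := by
      intro k
      obtain ⟨m, hm, hm0⟩ := key k
      obtain rfl : m = 0 := hm0.2 fun j _ h => hno ⟨j + 1, h⟩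
      rw [IsPeriodicPt, IsFixedPt, hm, div_left_inj' hq.ne', iterate_zero_apply, add_left_inj,
        Nat.cast_inj, ← Fin.ext_iff]
      rfl
    refine ⟨?_, ?_⟩
    · obtain ⟨k, hk, h⟩ := hper
      exact ⟨k, hk, (hiff k).2 h⟩
    · rw [ncard_forward_orbit_eq_minimalPeriod hper]
      exact minimalPeriod_eq_minimalPeriod_iff.2 hiff
end
end
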